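/- arXiv:2004.02737 — 2 statements merged into one kernel-verified Lean document; each statement's English description precedes it below -/
import Mathlib

section
/- Let K = ℚ(q, q̄, z), V = K^n, p = qⁿ·q̄, D = diag(q², q⁴, …, q^{2n}), R̃⁺(x) = R₂₁(1/(x·q̄²)) with R₂₁(w) = P·R(w)·P, and C = D₁⁻¹·R̃⁺₁₂(z)·D₁ ∈ End(V⊗V). Let ι be a finite type and W = K^ι. For arbitrary A, B ∈ End(V⊗W), let A_{2W} ∈ End(V⊗V⊗W) denote A acting in the second V-factor and W (identity in the first V-factor), let B_{1W} denote B acting in the first V-factor and W, and let R₁₂(z·p²) and C₁₂ act in the two V-factors. Then the partial trace over the two V-factors satisfies Tr_{V⊗V}(A_{2W} · R₁₂(z·p²) · B_{1W} · C₁₂) = Tr_{V⊗V}(A_{2W} · B_{1W}) in End(W). -/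
/-!
STATEMENT 6: With K = ℚ(q, q̄, z), V = K^n, p = qⁿ·q̄,
D = diag(q²,…,q^{2n}), R̃⁺(x) = R₂₁(1/(x·q̄²)),
C = D₁⁻¹·R̃⁺₁₂(z)·D₁, and W = K^ι for a finite type ι:
for all A, B ∈ End(V⊗W),
`Tr_{V⊗V}(A_{2W} · R₁₂(z·p²) · B_{1W} · C₁₂) = Tr_{V⊗V}(A_{2W} · B_{1W})`
in End(W).
-/

open MvPolynomial

noncomputable section

/-- The field ℚ(q, q̄, z). -/
abbrev K6 : Type := FractionRing (MvPolynomial (Fin 3) ℚ)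

noncomputable def q6 : K6 := algebraMap (MvPolynomial (Fin 3) ℚ) K6 (X 0)
noncomputable def qbar6 : K6 := algebraMap (MvPolynomial (Fin 3) ℚ) K6 (X 1)
noncomputable def z6 : K6 := algebraMap (MvPolynomial (Fin 3) ℚ) K6 (X 2)

/-- The trigonometric R-matrix on V ⊗ V. -/
def Rmat (n : ℕ) {K : Type*} [Field K] (q x : K) :
    Matrix (Fin n × Fin n) (Fin n × Fin n) K :=
  Matrix.of fun p r =>
    (if p = r then (if p.1 = p.2 then (q - x * q⁻¹) / (1 - x) else 1) else 0) +
    (if p.1 ≠ p.2 ∧ r.1 = p.2 ∧ r.2 = p.1 then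
      (q - q⁻¹) * (if p.1 < p.2 then x else 1) / (1 - x) else 0)

/-- The permutation operator `P = Σ_{i,j} E_ij ⊗ E_ji` on V ⊗ V. -/
def Pmat (n : ℕ) (K : Type*) [Field K] :
    Matrix (Fin n × Fin n) (Fin n × Fin n) K :=
  Matrix.of fun p r => if r.1 = p.2 ∧ r.2 = p.1 then 1 else 0

/-- `R̃⁺(x) = R₂₁(1/(x·q̄²)) = P · R(1/(x·q̄²)) · P`. -/
def Rtilde (n : ℕ) {K : Type*} [Field K] (q qbar x : K) :
    Matrix (Fin n × Fin n) (Fin n × Fin n) K :=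
  Pmat n K * Rmat n q (x * qbar ^ 2)⁻¹ * Pmat n K

/-- `D₁ = D ⊗ 1` where `D = diag(q², q⁴, …, q^{2n})`. -/
def D1 (n : ℕ) {K : Type*} [Field K] (q : K) :
    Matrix (Fin n × Fin n) (Fin n × Fin n) K :=
  Matrix.diagonal fun p => q ^ (2 * ((p.1 : ℕ) + 1))

/-- An operator `A` on V⊗W acting in the second V-factor and W of V⊗V⊗W. -/
def act2W (n : ℕ) {ι : Type*} [DecidableEq ι] {K : Type*} [Field K]
    (A : Matrix (Fin n × ι) (Fin n × ι) K) :
    Matrix (Fin n × Fin n × ι) (Fin n × Fin n × ι) K :=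
  Matrix.of fun p r => (if p.1 = r.1 then 1 else 0) *
    A (p.2.1, p.2.2) (r.2.1, r.2.2)

/-- An operator `B` on V⊗W acting in the first V-factor and W of V⊗V⊗W. -/
def act1W (n : ℕ) {ι : Type*} [DecidableEq ι] {K : Type*} [Field K]
    (B : Matrix (Fin n × ι) (Fin n × ι) K) :
    Matrix (Fin n × Fin n × ι) (Fin n × Fin n × ι) K :=
  Matrix.of fun p r => (if p.2.1 = r.2.1 then 1 else 0) *
    B (p.1, p.2.2) (r.1, r.2.2)

/-- An operator on V⊗V acting in the two V-factors of V⊗V⊗W. -/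
def act12 (n : ℕ) {ι : Type*} [DecidableEq ι] {K : Type*} [Field K]
    (Xm : Matrix (Fin n × Fin n) (Fin n × Fin n) K) :
    Matrix (Fin n × Fin n × ι) (Fin n × Fin n × ι) K :=
  Matrix.of fun p r => Xm (p.1, p.2.1) (r.1, r.2.1) *
    (if p.2.2 = r.2.2 then 1 else 0)

/-- The partial trace over the two V-factors of an operator on V⊗V⊗W. -/
def ptraceVV (n : ℕ) {ι : Type*} {K : Type*} [Field K]
    (M : Matrix (Fin n × Fin n × ι) (Fin n × Fin n × ι) K) : Matrix ι ι K :=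
  Matrix.of fun w w' => ∑ a : Fin n, ∑ b : Fin n, M (a, b, w) (a, b, w')

section RMatrix

variable {K : Type*} [Field K] (n : ℕ)

/-- The `R`-matrix with the off-diagonal part extended to all pairs of indices. -/
theorem Rmat_apply (q : K) {x : K} (hx : 1 - x ≠ 0) (i j k l : Fin n) :
    Rmat n q x (i, j) (k, l) =
      (if k = i then if l = j then if i = j then q⁻¹ else 1 else 0 else 0) +
      (if k = j then if l = i then
        (q - q⁻¹) / (1 - x) * (if i < j then x else 1) else 0 else 0) := by
  by_cases hij : i = j
  · subst hij
    by_cases hk : k = i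
    · by_cases hl : l = i
      · subst hk hl
        simp only [Rmat, Matrix.of_apply, if_true, ne_eq, not_true, false_and, if_false,
          lt_irrefl]
        field_simp
        ring
      · simp [Rmat, hk, hl, Ne.symm hl]
    · simp [Rmat, hk, Ne.symm hk]
  · simp only [Rmat, Matrix.of_apply, Prod.mk.injEq, ne_eq, hij, not_false_eq_true,
      if_false, ite_and, eq_comm (a := i) (b := k), eq_comm (a := j) (b := l)]
    congr 1
    split_ifs <;> ring

theorem Rtilde_apply (q qbar x : K) (i j k l : Fin n) :
    Rtilde n q qbar x (i, j) (k, l) = Rmat n q (x * qbar ^ 2)⁻¹ (j, i) (l, k) := by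
  simp [Rtilde, Matrix.mul_apply, Pmat, Fintype.sum_prod_type, ite_and]

theorem D1_conj_apply {q : K} (hq : q ≠ 0)
    (M : Matrix (Fin n × Fin n) (Fin n × Fin n) K) (i j k l : Fin n) :
    ((D1 n q)⁻¹ * M * D1 n q) (i, j) (k, l) =
      (q ^ (2 * ((i : ℕ) + 1)))⁻¹ * M (i, j) (k, l) * q ^ (2 * ((k : ℕ) + 1)) := by
  have h : (D1 n q)⁻¹ = Matrix.diagonal fun p : Fin n × Fin n =>
      (q ^ (2 * ((p.1 : ℕ) + 1)))⁻¹ := by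
    refine Matrix.inv_eq_left_inv ?_
    rw [D1, Matrix.diagonal_mul_diagonal, ← Matrix.diagonal_one]
    congr 1
    funext p
    exact inv_mul_cancel₀ (pow_ne_zero _ hq)
  rw [h, D1, Matrix.mul_diagonal, Matrix.diagonal_mul]

/-- A geometric sum with a weight that jumps at two positions. -/
theorem geom_sum_two_jumps (t u w : K) {b c : ℕ} (hcb : c ≤ b) (hbn : b ≤ n) :
    (∑ a ∈ Finset.range n, (if a < c then u else 1) * (if a < b then w else 1) * t ^ a) *
        (t - 1) = u * w * (t ^ c - 1) + w * (t ^ b - t ^ c) + (t ^ n - t ^ b) := by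
  induction n, hbn using Nat.le_induction with
  | base =>
    induction b, hcb using Nat.le_induction with
    | base =>
      rw [Finset.sum_congr rfl (g := fun a => u * w * t ^ a), ← Finset.mul_sum, mul_assoc,
        geom_sum_mul]
      · ring
      · intro a ha
        simp [Finset.mem_range.1 ha]
    | succ b hcb ih =>
      rw [Finset.sum_range_succ, add_mul, Finset.sum_congr rfl
        (g := fun a => (if a < c then u else 1) * (if a < b then w else 1) * t ^ a), ih]
      · simp [hcb.not_gt]
        ring
      · intro a ha
        have := Finset.mem_range.1 ha
        simp [this, this.trans (Nat.lt_succ_self b)]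
  | succ m hbm ih =>
    rw [Finset.sum_range_succ, add_mul, ih]
    simp [hbm.not_gt, (hcb.trans hbm).not_gt]
    ring

theorem off_diagonal_sum {q u w : K} (hq : q ≠ 0) (hu : 1 - u ≠ 0) (hw : 1 - w ≠ 0)
    (huw : u * w = q ^ (2 * n)) (b c : Fin n) :
    q⁻¹ * ((q - q⁻¹) / (1 - w) * (if c < b then w else 1)) * q ^ (2 * (c : ℕ)) +
        q⁻¹ * ((q - q⁻¹) / (1 - u) * (if b < c then u else 1)) * q ^ (2 * (b : ℕ)) +
        ∑ a : Fin n, (q - q⁻¹) / (1 - u) * (if a < c then u else 1) *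
          ((q - q⁻¹) / (1 - w) * (if a < b then w else 1)) * q ^ (2 * (a : ℕ)) =
      if b = c then (1 - (q⁻¹) ^ 2) * q ^ (2 * (b : ℕ)) else 0 := by
  have hsum : ∑ a : Fin n, (q - q⁻¹) / (1 - u) * (if a < c then u else 1) *
          ((q - q⁻¹) / (1 - w) * (if a < b then w else 1)) * q ^ (2 * (a : ℕ)) =
      (q - q⁻¹) / (1 - u) / (1 - w) / q * ((∑ a ∈ Finset.range n,
        (if a < (c : ℕ) then u else 1) * (if a < (b : ℕ) then w else 1) * (q ^ 2) ^ a) *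
          (q ^ 2 - 1)) := by
    rw [Finset.sum_range, Finset.sum_mul, Finset.mul_sum]
    refine Finset.sum_congr rfl fun a _ => ?_
    simp only [Fin.lt_def, pow_mul]
    field_simp
  rw [hsum]
  simp only [pow_mul] at huw ⊢
  rcases lt_trichotomy b c with h | h | h
  · have hs := geom_sum_two_jumps n (q ^ 2) w u (Fin.le_def.1 h.le) c.2.le
    simp only [mul_comm (ite _ w 1)] at hs
    rw [hs]
    simp only [h, h.not_gt, h.ne, if_true, if_false, ← huw]
    field_simp
    ring
  · subst h
    rw [geom_sum_two_jumps n (q ^ 2) u w le_rfl b.2.le]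
    simp only [lt_irrefl, if_true, if_false, ← huw]
    field_simp
    ring
  · rw [geom_sum_two_jumps n (q ^ 2) u w (Fin.le_def.1 h.le) b.2.le]
    simp only [h, h.not_gt, h.ne', if_true, if_false, ← huw]
    field_simp
    ring

/-- Contraction over `a` and `d` of two operators, each the sum of a diagonal operator and a
diagonal operator composed with the flip. -/
theorem sum_mul_diagonal_add_flip {σ : Type*} [Fintype σ] [DecidableEq σ]
    (e F G : σ → σ → K) (h : σ → K) (b b' c c' : σ) :
    ∑ a, ∑ d, ((if c = a then if d = b' then e a b' else 0 else 0) +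
          (if c = b' then if d = a then F a b' else 0 else 0)) *
        ((if b = d then if a = c' then e d c' else 0 else 0) +
          (if b = c' then if a = d then G d c' else 0 else 0)) * h a =
      (if b' = b then if c' = c then e c b * e b c * h c else 0 else 0) +
      (if c = b' then if b = c' then
        e c c * G c b * h c + e b b * F b c * h b + ∑ a, F a c * G a b * h a else 0 else 0) := by
  have hd (a : σ) (Y : σ → K) : ∑ d, ((if c = a then if d = b' then e a b' else 0 else 0) +
          (if c = b' then if d = a then F a b' else 0 else 0)) * Y d * h a =
      (if c = a then e a b' * Y b' * h a else 0) +
      (if c = b' then F a b' * Y a * h a else 0) := by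
    split_ifs <;> simp [add_mul, Finset.sum_add_distrib]
  simp_rw [hd, Finset.sum_add_distrib, Finset.sum_ite_eq, Finset.mem_univ, if_true]
  by_cases hc : c = b'
  · subst hc
    by_cases hb : b = c'
    · subst hb
      by_cases hbc : b = c
      · subst hbc
        simp [mul_add, add_mul, Finset.sum_add_distrib]
        ring
      · simp [hbc, Ne.symm hbc, mul_add, add_mul, Finset.sum_add_distrib]
        ring
    · by_cases hbc : b = c
      · subst hbc
        simp [hb, Ne.symm hb]
      · simp [hb, hbc, Ne.symm hbc]
  · simp [hc, eq_comm (a := b) (b := b'), eq_comm (a := c) (b := c'), mul_assoc]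
    split_ifs with hb hcc
    · rw [hb, hcc]
    all_goals rfl

/-- The crossing relation between `R(u)` and the conjugated flip of `R(w)` when
`u * w = q ^ (2 * n)`. -/
theorem Rmat_crossing {q u w : K} (hq : q ≠ 0) (hu : 1 - u ≠ 0) (hw : 1 - w ≠ 0)
    (huw : u * w = q ^ (2 * n)) (b b' c c' : Fin n) :
    ∑ a, ∑ d, Rmat n q u (a, b') (c, d) *
        ((q ^ (2 * ((c' : ℕ) + 1)))⁻¹ * Rmat n q w (d, c') (b, a) * q ^ (2 * ((a : ℕ) + 1))) =
      if b' = b then if c' = c then 1 else 0 else 0 := by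
  have hqc : q ^ (2 * (c' : ℕ)) ≠ 0 := pow_ne_zero _ hq
  have key : ∑ a, ∑ d, Rmat n q u (a, b') (c, d) * Rmat n q w (d, c') (b, a) *
        q ^ (2 * (a : ℕ)) =
      if b' = b then if c' = c then q ^ (2 * (c' : ℕ)) else 0 else 0 := by
    have hoff := off_diagonal_sum n hq hu hw huw b c
    simp only [Rmat_apply n q hu, Rmat_apply n q hw]
    rw [sum_mul_diagonal_add_flip (fun i j => if i = j then q⁻¹ else 1)
      (fun i j => (q - q⁻¹) / (1 - u) * (if i < j then u else 1))
      (fun i j => (q - q⁻¹) / (1 - w) * (if i < j then w else 1))]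
    simp only [if_true]
    rw [hoff]
    by_cases hbc : b = c
    · subst hbc
      simp only [eq_comm (a := b) (b := b'), eq_comm (a := b) (b := c'), if_true]
      split_ifs with hb hc
      · rw [hc]
        ring
      all_goals simp
    · simp only [hbc, Ne.symm hbc, if_false, ite_self, add_zero, one_mul]
      split_ifs with hb hc
      · rw [hc]
      all_goals rfl
  calc _ = (∑ a, ∑ d, Rmat n q u (a, b') (c, d) * Rmat n q w (d, c') (b, a) *
        q ^ (2 * (a : ℕ))) / q ^ (2 * (c' : ℕ)) := by
        simp only [Finset.sum_div]
        refine Finset.sum_congr rfl fun a _ => Finset.sum_congr rfl fun d _ => ?_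
        simp only [mul_add, pow_add]
        field_simp
    _ = _ := by
        rw [key]
        split_ifs <;> simp [hqc]

variable {ι : Type*} [Fintype ι] [DecidableEq ι]

theorem act2W_mul_act12_apply (A : Matrix (Fin n × ι) (Fin n × ι) K)
    (X : Matrix (Fin n × Fin n) (Fin n × Fin n) K) (a b c d : Fin n) (s t : ι) :
    (act2W n A * act12 n X : Matrix (Fin n × Fin n × ι) (Fin n × Fin n × ι) K) (a, b, s) (c, d, t) =
      ∑ b', A (b, s) (b', t) * X (a, b') (c, d) := by
  simp [Matrix.mul_apply, act2W, act12, Fintype.sum_prod_type]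

theorem act1W_mul_act12_apply (B : Matrix (Fin n × ι) (Fin n × ι) K)
    (Y : Matrix (Fin n × Fin n) (Fin n × Fin n) K) (a b c d : Fin n) (s t : ι) :
    (act1W n B * act12 n Y : Matrix (Fin n × Fin n × ι) (Fin n × Fin n × ι) K) (c, d, s) (a, b, t) =
      ∑ c', B (c, s) (c', t) * Y (c', d) (a, b) := by
  simp [Matrix.mul_apply, act1W, act12, Fintype.sum_prod_type]

theorem ptraceVV_apply (A B : Matrix (Fin n × ι) (Fin n × ι) K)
    (X Y : Matrix (Fin n × Fin n) (Fin n × Fin n) K) (s t : ι) :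
    ptraceVV n (act2W n A * act12 n X * act1W n B * act12 n Y) s t =
      ∑ b, ∑ c, ∑ r, ∑ b', ∑ c', A (b, s) (b', r) * B (c, r) (c', t) *
        ∑ a, ∑ d, X (a, b') (c, d) * Y (c', d) (a, b) := by
  rw [Matrix.mul_assoc]
  simp only [ptraceVV, Matrix.of_apply]
  simp_rw [Matrix.mul_apply (M := act2W n A * act12 n X), Fintype.sum_prod_type,
    act2W_mul_act12_apply, act1W_mul_act12_apply, Finset.sum_mul_sum, Finset.mul_sum]
  rw [Finset.sum_comm]
  refine Finset.sum_congr rfl fun b _ => ?_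
  rw [Finset.sum_comm]
  refine Finset.sum_congr rfl fun c _ => ?_
  have hcomm (f : Fin n → Fin n → ι → Fin n → Fin n → K) :
      ∑ a, ∑ d, ∑ r, ∑ b', ∑ c', f a d r b' c' = ∑ r, ∑ b', ∑ c', ∑ a, ∑ d, f a d r b' c' := by
    simp only [← Finset.sum_product', Finset.univ_product_univ]
    exact Fintype.sum_equiv
      ⟨fun x => (x.2.2.1, x.2.2.2.1, x.2.2.2.2, x.1, x.2.1),
        fun x => (x.2.2.2.1, x.2.2.2.2, x.1, x.2.1, x.2.2.1), fun _ => rfl, fun _ => rfl⟩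
      _ _ fun _ => rfl
  rw [hcomm]
  simp only [mul_mul_mul_comm]

end RMatrix

theorem algebraMap_ne_one {f : MvPolynomial (Fin 3) ℚ} (hf : eval 0 f = 0) :
    algebraMap (MvPolynomial (Fin 3) ℚ) K6 f ≠ 1 := by
  intro h
  rw [← map_one (algebraMap (MvPolynomial (Fin 3) ℚ) K6)] at h
  rw [IsFractionRing.injective (MvPolynomial (Fin 3) ℚ) K6 h, map_one] at hf
  exact one_ne_zero hf

theorem algebraMap_X_ne_zero (i : Fin 3) :
    algebraMap (MvPolynomial (Fin 3) ℚ) K6 (X i) ≠ 0 :=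
  (map_ne_zero_iff _ (IsFractionRing.injective (MvPolynomial (Fin 3) ℚ) K6)).2 (X_ne_zero i)

/-- `Tr_{V⊗V}(A_{2W} · R₁₂(z·p²) · B_{1W} · C₁₂) = Tr_{V⊗V}(A_{2W} · B_{1W})`
with `C = D₁⁻¹ · R̃⁺₁₂(z) · D₁` and `p = qⁿ·q̄`. -/
theorem partial_trace_cancellation (n : ℕ) (hn : 1 ≤ n)
    (ι : Type*) [Fintype ι] [DecidableEq ι]
    (A B : Matrix (Fin n × ι) (Fin n × ι) K6) :
    ptraceVV n (act2W n A * act12 n (Rmat n q6 (z6 * (q6 ^ n * qbar6) ^ 2)) *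
        act1W n B * act12 n ((D1 n q6)⁻¹ * Rtilde n q6 qbar6 z6 * D1 n q6))
      = ptraceVV n (act2W n A * act1W n B) := by
  have hq : q6 ≠ 0 := algebraMap_X_ne_zero 0
  have hqbar : qbar6 ≠ 0 := algebraMap_X_ne_zero 1
  have hz : z6 ≠ 0 := algebraMap_X_ne_zero 2
  have hu : 1 - z6 * (q6 ^ n * qbar6) ^ 2 ≠ 0 := by
    have h := algebraMap_ne_one (f := X 2 * (X 0 ^ n * X 1) ^ 2) (by simp)
    simp only [map_mul, map_pow] at h
    exact sub_ne_zero.2 h.symm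
  have hw : 1 - (z6 * qbar6 ^ 2)⁻¹ ≠ 0 := by
    have h := algebraMap_ne_one (f := X 2 * X 1 ^ 2) (by simp)
    simp only [map_mul, map_pow] at h
    exact sub_ne_zero.2 fun h' => h (inv_eq_one.1 h'.symm)
  have huw : z6 * (q6 ^ n * qbar6) ^ 2 * (z6 * qbar6 ^ 2)⁻¹ = q6 ^ (2 * n) := by
    rw [pow_mul']
    field_simp
  ext s t
  rw [ptraceVV_apply]
  simp_rw [D1_conj_apply n hq, Rtilde_apply, Rmat_crossing n hq hu hw huw]
  simp only [ptraceVV, Matrix.of_apply, Matrix.mul_apply, act2W, act1W, Fintype.sum_prod_type]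
  simp only [mul_ite, ite_mul, mul_one, one_mul, mul_zero, zero_mul, Finset.sum_ite_eq',
    Finset.sum_ite_eq, Finset.sum_ite_irrel, Finset.sum_const_zero, Finset.mem_univ, if_true]
  exact Finset.sum_comm

end
end

section
/- Fix integers i < j, a positive integer k, and an integer n ≥ 1, and work in the field F = ℚ(q, u, z_i, z_{i+1}, …, z_{j−1}) of rational functions. For each chain j = c₀ > c₁ > ⋯ > c_t = i (with t ≥ 1) together with positive integers k₁, …, k_t summing to k and satisfying the strict slope condition (c₀ − c₁)/k₁ > (c₁ − c₂)/k₂ > ⋯ > (c_{t−1} − c_t)/k_t, let α(v) = Σ_{s=1}^{t} [ (k_s(c_{s−1} − c_s) − k_s − (c_{s−1} − c_s) + gcd(c_{s−1} − c_s, k_s))/2 + k_s(c₀ − c_{s−1}) ]. Then the sum, over all such data (t; c₀,…,c_t; k₁,…,k_t), of (q²u)^{α(v) − (k−1)(j−i) + k} · (−q²u)^{i−j} · Π_{s=1}^{t} Π_{a=c_s}^{c_{s−1}−1} (z_a · u^a)^{⌊(a−c_s+1)·k_s/(c_{s−1}−c_s)⌋ − ⌊(a−c_s)·k_s/(c_{s−1}−c_s)⌋}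 · Π_{s=1}^{t−1} (1 − z_{c_s}/(z_{c_s − 1}·q²)) (where z_{c_s − 1} is the variable with index c_s − 1) equals (z_i · u^i)^k · (−z_{j−1})/(z_i · (−q²)^{j−i−1}). -/
/-!
STATEMENT 12: The rational-function identity underlying the proof that the
sum of ordered products of the shuffle elements Ā^{(k_s)} (weighted by powers
of p) equals the shuffle element A_{[i;j),k}.

Fix integers i < j, a positive integer k and an integer n ≥ 1, and work in
the field F = ℚ(q, u, z_i, …, z_{j−1}).  The sum, over all chains
j = c₀ > c₁ > ⋯ > c_t = i with positive integers k₁, …, k_t summing to k and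
satisfying the strict slope condition
(c₀−c₁)/k₁ > (c₁−c₂)/k₂ > ⋯ > (c_{t−1}−c_t)/k_t, of
  (q²u)^{α(v) − (k−1)(j−i) + k} · (−q²u)^{i−j}
  · Π_{s=1}^{t} Π_{a=c_s}^{c_{s−1}−1}
      (z_a·u^a)^{⌊(a−c_s+1)k_s/(c_{s−1}−c_s)⌋ − ⌊(a−c_s)k_s/(c_{s−1}−c_s)⌋}
  · Π_{s=1}^{t−1} (1 − z_{c_s}/(z_{c_s−1}·q²))
equals (z_i·u^i)^k · (−z_{j−1})/(z_i·(−q²)^{j−i−1}).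

Chains are encoded as data D = (t, c, kk) ∈ ℕ × (ℕ → ℤ) × (ℕ → ℤ), with the
functions c and kk normalized outside the relevant range {0,…,t} (so that each
chain corresponds to exactly one datum), and the sum is the `finsum` over the
set of valid data (which is a finite set).
-/

open MvPolynomial

noncomputable section

/-- The variable set {q, u} ⊔ {z_i, …, z_{j−1}}. -/
abbrev Vars (i j : ℤ) : Type := Fin 2 ⊕ {a : ℤ // i ≤ a ∧ a ≤ j - 1}

/-- The field F = ℚ(q, u, z_i, …, z_{j−1}). -/
abbrev F (i j : ℤ) : Type := FractionRing (MvPolynomial (Vars i j) ℚ)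

/-- The variable q. -/
noncomputable def qF (i j : ℤ) : F i j :=
  algebraMap (MvPolynomial (Vars i j) ℚ) (F i j) (X (Sum.inl 0))

/-- The variable u. -/
noncomputable def uF (i j : ℤ) : F i j :=
  algebraMap (MvPolynomial (Vars i j) ℚ) (F i j) (X (Sum.inl 1))

/-- The variables z_a for i ≤ a ≤ j−1 (and junk value 0 outside this range;
only in-range indices occur in the statement). -/
noncomputable def zF (i j : ℤ) (a : ℤ) : F i j :=
  if h : i ≤ a ∧ a ≤ j - 1 then
    algebraMap (MvPolynomial (Vars i j) ℚ) (F i j) (X (Sum.inr ⟨a, h⟩))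
  else 0

/-- The exponent statistic
`α(v) = Σ_{s=1}^{t} [ (k_s(c_{s−1}−c_s) − k_s − (c_{s−1}−c_s)
  + gcd(c_{s−1}−c_s, k_s))/2 + k_s(c₀−c_{s−1}) ]`
attached to a chain datum (each summand's numerator being even, the integer
division by 2 is exact). -/
def alphaV (c kk : ℕ → ℤ) (t : ℕ) : ℤ :=
  ∑ s ∈ Finset.Icc 1 t,
    ((kk s * (c (s - 1) - c s) - kk s - (c (s - 1) - c s)
        + (Int.gcd (c (s - 1) - c s) (kk s) : ℤ)) / 2
      + kk s * (c 0 - c (s - 1)))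

/-- Validity of a chain datum D = (t, c, kk):  t ≥ 1, the c's form a chain
j = c₀ > c₁ > ⋯ > c_t = i, the k's are positive with k₁ + ⋯ + k_t = k, the
slopes (c_{s−1}−c_s)/k_s are strictly decreasing, and c, kk are normalized
outside the range {0,…,t} resp. {1,…,t}. -/
def ChainValid (i j k : ℤ) (D : ℕ × (ℕ → ℤ) × (ℕ → ℤ)) : Prop :=
  1 ≤ D.1 ∧ D.2.1 0 = j ∧ D.2.1 D.1 = i ∧
  (∀ s, s < D.1 → D.2.1 (s + 1) < D.2.1 s) ∧
  (∀ s, D.1 ≤ s → D.2.1 s = i) ∧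
  (∀ s, 1 ≤ s → s ≤ D.1 → 1 ≤ D.2.2 s) ∧
  D.2.2 0 = 0 ∧ (∀ s, D.1 < s → D.2.2 s = 0) ∧
  (∑ s ∈ Finset.Icc 1 D.1, D.2.2 s = k) ∧
  (∀ s, 1 ≤ s → s < D.1 →
    ((D.2.1 (s - 1) - D.2.1 s : ℤ) : ℚ) / ((D.2.2 s : ℤ) : ℚ)
      > ((D.2.1 s - D.2.1 (s + 1) : ℤ) : ℚ) / ((D.2.2 (s + 1) : ℤ) : ℚ))

/-- The summand attached to a chain datum D = (t, c, kk):
`(q²u)^{α(v) − (k−1)(j−i) + k} · (−q²u)^{i−j}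
  · Π_{s=1}^{t} Π_{a=c_s}^{c_{s−1}−1}
      (z_a u^a)^{⌊(a−c_s+1)k_s/(c_{s−1}−c_s)⌋ − ⌊(a−c_s)k_s/(c_{s−1}−c_s)⌋}
  · Π_{s=1}^{t−1} (1 − z_{c_s}/(z_{c_s−1} q²))`. -/
noncomputable def ChainTerm (i j k : ℤ) (D : ℕ × (ℕ → ℤ) × (ℕ → ℤ)) : F i j :=
  (qF i j ^ 2 * uF i j) ^ (alphaV D.2.1 D.2.2 D.1 - (k - 1) * (j - i) + k) *
  (-(qF i j ^ 2 * uF i j)) ^ (i - j) *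
  (∏ s ∈ Finset.Icc 1 D.1, ∏ a ∈ Finset.Icc (D.2.1 s) (D.2.1 (s - 1) - 1),
      (zF i j a * uF i j ^ a) ^
        ((a - D.2.1 s + 1) * D.2.2 s / (D.2.1 (s - 1) - D.2.1 s)
          - (a - D.2.1 s) * D.2.2 s / (D.2.1 (s - 1) - D.2.1 s))) *
  (∏ s ∈ Finset.Icc 1 (D.1 - 1),
      (1 - zF i j (D.2.1 s) / (zF i j (D.2.1 s - 1) * qF i j ^ 2)))


open Classical in
/-- Möbius-type summation over a finite intersection-closed family of integer-valued functions
in which one can always descend by one unit at a single coordinate. -/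
theorem sum_prod_zpow_mul_prod_one_sub_inv {ι R : Type*} [DecidableEq ι] [Field R]
    (I : Finset ι) (v : ι → R) (hv : ∀ c ∈ I, v c ≠ 0) (𝒦 : Finset (ι → ℤ)) (E : ι → ℤ)
    (hE : E ∈ 𝒦) (hle : ∀ K ∈ 𝒦, K ≤ E)
    (hinf : ∀ K ∈ 𝒦, ∀ L ∈ 𝒦, K ⊓ L ∈ 𝒦)
    (hdesc : ∀ K ∈ 𝒦, ∀ L ∈ 𝒦, K ≤ L → K ≠ L →
      ∃ c ∈ I, K c < L c ∧ L - Pi.single c 1 ∈ 𝒦) :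
    ∑ K ∈ 𝒦, (∏ c ∈ I, v c ^ K c) *
        ∏ c ∈ I with K - Pi.single c 1 ∈ 𝒦, (1 - (v c)⁻¹) = ∏ c ∈ I, v c ^ E c := by
  induction h𝒦 : 𝒦.card using Nat.strong_induction_on generalizing 𝒦 E with
  | _ N ih =>
  subst h𝒦
  by_cases hne : ∃ K ∈ 𝒦, K ≠ E
  · obtain ⟨K₀, hK₀, hK₀E⟩ := hne
    obtain ⟨c, hcI, -, hcE⟩ := hdesc K₀ hK₀ E hE (hle K₀ hK₀) hK₀E
    have hsplit := Finset.sum_filter_add_sum_filter_not 𝒦 (fun K => K c = E c)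
      (fun K => (∏ c ∈ I, v c ^ K c) *
        ∏ c ∈ I with K - Pi.single c 1 ∈ 𝒦, (1 - (v c)⁻¹))
    rw [← hsplit]
    have h1 := ih (𝒦.filter fun K => K c = E c).card
      (Finset.card_lt_card (Finset.filter_ssubset.2 ⟨_, hcE, by simp⟩))
      (𝒦.filter fun K => K c = E c) E (by simp [hE])
      (fun K hK => hle K (Finset.mem_filter.1 hK).1)
      (fun K hK L hL => by
        simp only [Finset.mem_filter] at hK hL ⊢
        exact ⟨hinf K hK.1 L hL.1, by simp [hK.2, hL.2]⟩)
      (fun K hK L hL hKL hne => by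
        simp only [Finset.mem_filter] at hK hL ⊢
        obtain ⟨x, hx, hlt, hmem⟩ := hdesc K hK.1 L hL.1 hKL hne
        have hxc : c ≠ x := by rintro rfl; omega
        exact ⟨x, hx, hlt, hmem, by simp [hxc, hL.2]⟩) rfl
    have h0 := ih (𝒦.filter fun K => ¬ K c = E c).card
      (Finset.card_lt_card (Finset.filter_ssubset.2 ⟨_, hE, by simp⟩))
      (𝒦.filter fun K => ¬ K c = E c) (E - Pi.single c 1) (by simp [hcE])
      (fun K hK x => by
        simp only [Finset.mem_filter] at hK
        have h2 : K x ≤ E x := hle K hK.1 x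
        by_cases hx : x = c
        · subst hx
          simp only [Pi.sub_apply, Pi.single_eq_same]
          have := hK.2
          omega
        · simpa [hx] using h2)
      (fun K hK L hL => by
        simp only [Finset.mem_filter] at hK hL ⊢
        refine ⟨hinf K hK.1 L hL.1, ?_⟩
        have h2 : K c ≤ E c := hle K hK.1 c
        have h3 : L c ≤ E c := hle L hL.1 c
        simp only [Pi.inf_apply]
        rcases le_total (K c) (L c) with h | h
        · rw [inf_eq_left.2 h]; exact hK.2
        · rw [inf_eq_right.2 h]; exact hL.2)
      (fun K hK L hL hKL hne => by
        simp only [Finset.mem_filter] at hK hL ⊢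
        obtain ⟨x, hx, hlt, hmem⟩ := hdesc K hK.1 L hL.1 hKL hne
        have h3 : L c ≤ E c := hle L hL.1 c
        refine ⟨x, hx, hlt, hmem, ?_⟩
        have := hL.2
        by_cases hxc : c = x
        · subst hxc
          simp only [Pi.sub_apply, Pi.single_eq_same]; omega
        · simpa [hxc] using this) rfl
    have e1 : ∑ K ∈ 𝒦 with K c = E c, (∏ c ∈ I, v c ^ K c) *
          ∏ c ∈ I with K - Pi.single c 1 ∈ 𝒦, (1 - (v c)⁻¹) =
        (1 - (v c)⁻¹) * ∏ c ∈ I, v c ^ E c := by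
      rw [← h1, Finset.mul_sum]
      refine Finset.sum_congr rfl fun K hK => ?_
      simp only [Finset.mem_filter] at hK
      have hmem : K - Pi.single c 1 ∈ 𝒦 := by
        have : K - Pi.single c 1 = K ⊓ (E - Pi.single c 1) := by
          ext x
          have h2 : K x ≤ E x := hle K hK.1 x
          by_cases hx : x = c
          · subst hx
            simp [hK.2]
          · simpa [hx] using h2
        rw [this]
        exact hinf _ hK.1 _ hcE
      have hset : (I.filter fun x => K - Pi.single x 1 ∈ 𝒦) =
          insert c (I.filter fun x => K - Pi.single x 1 ∈ 𝒦.filter fun K => K c = E c) := by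
        ext x
        simp only [Finset.mem_filter, Finset.mem_insert]
        by_cases hx : x = c
        · subst hx; simp [hcI, hmem]
        · have hx' : c ≠ x := fun h => hx h.symm
          simp [hx, hx', hK.2]
      rw [hset, Finset.prod_insert (by simp [hK.2])]
      ring
    have e0 : ∑ K ∈ 𝒦 with ¬ K c = E c, (∏ c ∈ I, v c ^ K c) *
          ∏ c ∈ I with K - Pi.single c 1 ∈ 𝒦, (1 - (v c)⁻¹) =
        (v c)⁻¹ * ∏ c ∈ I, v c ^ E c := by
      have e2 : (v c)⁻¹ * ∏ c ∈ I, v c ^ E c = ∏ x ∈ I, v x ^ (E - Pi.single c 1 : ι → ℤ) x := by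
        rw [← Finset.mul_prod_erase I _ hcI, ← Finset.mul_prod_erase I _ hcI, ← mul_assoc]
        congr 1
        · simp only [Pi.sub_apply, Pi.single_eq_same]
          rw [zpow_sub_one₀ (hv c hcI), mul_comm]
        · refine Finset.prod_congr rfl fun x hx => ?_
          simp [Finset.ne_of_mem_erase hx]
      rw [e2, ← h0]
      refine Finset.sum_congr rfl fun K hK => ?_
      simp only [Finset.mem_filter] at hK
      congr 1
      refine Finset.prod_congr ?_ fun _ _ => rfl
      refine Finset.filter_congr fun x _ => ?_
      simp only [Finset.mem_filter]
      refine ⟨fun h => ⟨h, ?_⟩, fun h => h.1⟩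
      have h2 : K c ≤ E c := hle K hK.1 c
      have h3 := hK.2
      by_cases hxc : c = x
      · subst hxc
        simp only [Pi.sub_apply, Pi.single_eq_same]; omega
      · simpa [hxc] using h3
    rw [e1, e0]
    ring
  · push Not at hne
    have : 𝒦 = {E} := Finset.eq_singleton_iff_unique_mem.2 ⟨hE, hne⟩
    subst this
    have : (I.filter fun x => E - Pi.single x 1 ∈ ({E} : Finset (ι → ℤ))) = ∅ := by
      refine Finset.filter_eq_empty_iff.2 fun x _ h => ?_
      have := congrFun (Finset.mem_singleton.1 h) x
      simp at this
    rw [Finset.sum_singleton, this]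
    simp

theorem card_filter_dvd_mul (d k : ℕ) (hd : 0 < d) :
    (Finset.filter (fun a => d ∣ a * k) (Finset.Ioc 0 d)).card = d.gcd k := by
  have hg : 0 < d.gcd k := Nat.gcd_pos_of_pos_left k hd
  have h : ∀ a ∈ Finset.Ioc 0 d, (d ∣ a * k ↔ d / d.gcd k ∣ a) := fun a _ => by
    rw [mul_comm]
    constructor
    · intro h
      refine Nat.Coprime.dvd_of_dvd_mul_left (Nat.coprime_div_gcd_div_gcd hg) ?_
      rw [Nat.div_mul_right_comm (Nat.gcd_dvd_right d k)]
      exact Nat.div_dvd_div (Nat.gcd_dvd_left d k) h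
    · rintro ⟨b, rfl⟩
      obtain ⟨m, hm⟩ := Nat.gcd_dvd_right d k
      refine ⟨m * b, ?_⟩
      calc k * (d / d.gcd k * b) = d.gcd k * m * (d / d.gcd k * b) := by rw [← hm]
        _ = d / d.gcd k * d.gcd k * (m * b) := by ring
        _ = d * (m * b) := by rw [Nat.div_mul_cancel (Nat.gcd_dvd_left d k)]
  rw [Finset.filter_congr h, Nat.Ioc_filter_dvd_card_eq_div,
    Nat.div_div_self (Nat.gcd_dvd_left d k) hd.ne']

theorem ediv_add_ediv_sub (d k a : ℤ) (hd : 0 < d) :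
    a * k / d + (d - a) * k / d = k - 1 + if d ∣ a * k then 1 else 0 := by
  have e : (d - a) * k / d = k + -(a * k) / d := by
    rw [show (d - a) * k = -(a * k) + k * d by ring, Int.add_mul_ediv_right _ _ hd.ne']
    ring
  rw [e]
  split_ifs with h
  · obtain ⟨m, hm⟩ := h
    rw [hm, ← mul_neg, Int.mul_ediv_cancel_left _ hd.ne', Int.mul_ediv_cancel_left _ hd.ne']
    ring
  · have h1 := Int.emod_add_mul_ediv (a * k) d
    have h2 := Int.emod_nonneg (a * k) hd.ne'
    have h3 := Int.emod_lt_of_pos (a * k) hd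
    have h4 : a * k % d ≠ 0 := fun h0 => h (Int.dvd_of_emod_eq_zero h0)
    have h5 : -(a * k) / d = -(a * k / d) - 1 := by
      rw [Int.ediv_eq_iff_of_pos hd]
      constructor <;> nlinarith [lt_of_le_of_ne h2 h4.symm]
    rw [h5]
    ring

theorem two_mul_sum_Ico_mul_ediv (d k : ℤ) (hd : 0 < d) (hk : 0 ≤ k) :
    2 * ∑ a ∈ Finset.Ico 0 d, a * k / d = k * d - k - d + Int.gcd d k := by
  have hreflect : ∑ a ∈ Finset.Ico 0 d, a * k / d + k
      = ∑ a ∈ Finset.Ioc 0 d, a * k / d := by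
    rw [← Finset.sum_Ioo_add_eq_sum_Ioc hd, ← Finset.sum_Ioo_add_eq_sum_Ico hd]
    simp [Int.mul_ediv_cancel_left _ hd.ne']
  have hrev : ∑ a ∈ Finset.Ioc 0 d, (d - a) * k / d = ∑ a ∈ Finset.Ico 0 d, a * k / d := by
    refine Finset.sum_nbij' (fun a => d - a) (fun a => d - a) ?_ ?_ ?_ ?_ ?_ <;>
      simp only [Finset.mem_Ico, Finset.mem_Ioc] <;> intros <;> first | omega | trivial
  have hcount : ((Finset.Ioc 0 d).filter fun a => d ∣ a * k).card = Int.gcd d k := by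
    lift d to ℕ using hd.le
    lift k to ℕ using hk
    rw [Int.gcd_natCast_natCast, ← card_filter_dvd_mul d k (by exact_mod_cast hd)]
    symm
    refine Finset.card_nbij (fun a : ℕ => (a : ℤ)) ?_ ?_ ?_
    · intro a ha
      simp only [Finset.mem_Ioc, Finset.coe_filter, Set.mem_ofPred_eq] at ha ⊢
      exact_mod_cast ha
    · exact Nat.cast_injective.injOn
    · intro a ha
      simp only [Finset.coe_filter, Finset.mem_Ioc, Set.mem_ofPred_eq] at ha
      lift a to ℕ using ha.1.1.le
      refine ⟨a, ?_, rfl⟩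
      simp only [Finset.coe_filter, Finset.mem_Ioc, Set.mem_ofPred_eq]
      exact_mod_cast ha
  have hpair : ∑ a ∈ Finset.Ioc 0 d, (a * k / d + (d - a) * k / d)
      = d * (k - 1) + Int.gcd d k := by
    rw [Finset.sum_congr rfl fun a _ => ediv_add_ediv_sub d k a hd, Finset.sum_add_distrib,
      ← hcount]
    simp [hd.le]
    ring
  rw [Finset.sum_add_distrib, hrev, ← hreflect] at hpair
  linarith

theorem sum_Ico_mul_ediv (d k : ℤ) (hd : 0 < d) (hk : 0 ≤ k) :
    ∑ a ∈ Finset.Ico 0 d, a * k / d = (k * d - k - d + Int.gcd d k) / 2 := by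
  rw [← two_mul_sum_Ico_mul_ediv d k hd hk]; omega

/-- Strict concavity of `G` at `b` relative to `[i, j]`: the point `(b, G b)` lies strictly above
every chord of `G` over an interval of `[i, j]` having `b` in its interior. -/
def IsStrictAt (i j : ℤ) (G : ℤ → ℤ) (b : ℤ) : Prop :=
  ∀ a c, i ≤ a → a < b → b < c → c ≤ j → (c - b) * G a + (b - a) * G c < (c - a) * G b

/-- Integer functions running from `0` at `i` to `k` at `j` that are the integer part of their
concave envelope on `[i, j]` and stay below `k` to the left of `j`. -/
def latticeConcave (i j k : ℤ) : Set (ℤ → ℤ) :=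
  {G | (∀ a, a ≤ i → G a = 0) ∧ (∀ a, j ≤ a → G a = k) ∧ (∀ a, a < j → G a ≤ k - 1) ∧
    ∀ a b c, i ≤ a → a < b → b < c → c ≤ j →
      (c - b) * G a + (b - a) * G c < (c - a) * (G b + 1)}

open Classical in
/-- The points of strict concavity of `G` in `[i, j]`, the endpoints included. -/
def vertexSet (i j : ℤ) (G : ℤ → ℤ) : Finset ℤ :=
  (Finset.Icc i j).filter (IsStrictAt i j G)

theorem mem_vertexSet {i j : ℤ} {G : ℤ → ℤ} {b : ℤ} :
    b ∈ vertexSet i j G ↔ (i ≤ b ∧ b ≤ j) ∧ IsStrictAt i j G b := by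
  simp [vertexSet]

theorem left_mem_vertexSet {i j : ℤ} (hij : i < j) (G : ℤ → ℤ) : i ∈ vertexSet i j G :=
  mem_vertexSet.2 ⟨⟨le_rfl, hij.le⟩, fun a c h1 h2 => by omega⟩

theorem right_mem_vertexSet {i j : ℤ} (hij : i < j) (G : ℤ → ℤ) : j ∈ vertexSet i j G :=
  mem_vertexSet.2 ⟨⟨hij.le, le_rfl⟩, fun a c _ _ h1 h2 => by omega⟩

/-- Between consecutive vertices an integer function lies below the chord. -/
theorem le_chord_of_consecutive {i j : ℤ} {G : ℤ → ℤ} {c c' : ℤ} (hcc : c < c')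
    (hc : c ∈ vertexSet i j G) (hc' : c' ∈ vertexSet i j G)
    (hno : ∀ b, c < b → b < c' → b ∉ vertexSet i j G) {b : ℤ} (hcb : c ≤ b) (hbc : b ≤ c') :
    (c' - c) * G b ≤ (c' - b) * G c + (b - c) * G c' := by
  rw [mem_vertexSet] at hc hc'
  set φ : ℤ → ℤ := fun b => (c' - c) * G b - ((c' - b) * G c + (b - c) * G c') with hφ
  by_contra hlt
  have hpos : 0 < φ b := by simp only [hφ]; linarith
  obtain ⟨M, hM, hmax⟩ := (Finset.Icc i j).exists_max_image φ ⟨b, by simp; omega⟩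
  have hMS : ((Finset.Icc i j).filter fun x => φ x = φ M).Nonempty := ⟨M, by simpa using hM⟩
  obtain ⟨x, hx, hmin⟩ := Finset.exists_min_image _ id hMS
  simp only [Finset.mem_filter, Finset.mem_Icc, id] at hx hmin hmax
  have hxpos : 0 < φ x := by
    rw [hx.2]; exact hpos.trans_le (hmax b ⟨by omega, by omega⟩)
  have hleft : ∀ a, i ≤ a → a < x → φ a < φ x := fun a h1 h2 => by
    refine lt_of_le_of_ne (hx.2 ▸ hmax a ⟨h1, by omega⟩) fun h => ?_
    have := hmin a ⟨⟨h1, by omega⟩, h.trans hx.2⟩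
    omega
  have hright : ∀ a, i ≤ a → a ≤ j → φ a ≤ φ x := fun a h1 h2 => hx.2 ▸ hmax a ⟨h1, h2⟩
  rcases lt_trichotomy x c with h | h | h
  · have := hc.2 x c' hx.1.1 h hcc hc'.1.2
    simp only [hφ] at hxpos
    nlinarith
  · simp only [hφ, h] at hxpos
    nlinarith
  rcases lt_trichotomy x c' with h' | h' | h'
  · refine hno x h h' (mem_vertexSet.2 ⟨hx.1, fun a e h1 h2 h3 h4 => ?_⟩)
    have ha := hleft a h1 h2
    have he := hright e (by omega) h4
    have h5 : (e - x) * φ a + (x - a) * φ e < (e - a) * φ x := by nlinarith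
    have h6 : (c' - c) * ((e - x) * G a + (x - a) * G e) < (c' - c) * ((e - a) * G x) := by
      simp only [hφ] at h5
      linarith
    exact lt_of_mul_lt_mul_left h6 (by omega)
  · simp only [hφ, h'] at hxpos
    nlinarith
  · have := hc'.2 c x hc.1.1 hcc h' hx.1.2
    simp only [hφ] at hxpos
    nlinarith

theorem exists_consecutive {i j : ℤ} (hij : i < j) (G : ℤ → ℤ) {b : ℤ} (hib : i ≤ b) (hbj : b < j) :
    ∃ c c', c ≤ b ∧ b < c' ∧ c ∈ vertexSet i j G ∧ c' ∈ vertexSet i j G ∧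
      ∀ x, c < x → x < c' → x ∉ vertexSet i j G := by
  obtain ⟨c, hc, hmax⟩ := ((vertexSet i j G).filter (· ≤ b)).exists_max_image id
    ⟨i, by simp [left_mem_vertexSet hij, hib]⟩
  obtain ⟨c', hc', hmin⟩ := ((vertexSet i j G).filter (b < ·)).exists_min_image id
    ⟨j, by simp [right_mem_vertexSet hij, hbj]⟩
  simp only [Finset.mem_filter, id] at hc hc' hmax hmin
  refine ⟨c, c', hc.2, hc'.2, hc.1, hc'.1, fun x h1 h2 hx => ?_⟩
  rcases le_or_gt x b with h | h
  · have := hmax x ⟨hx, h⟩; omega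
  · have := hmin x ⟨hx, h⟩; omega

/-- Between consecutive vertices a lattice-concave function is the integer part of its chord. -/
theorem eq_add_ediv_of_consecutive {i j k : ℤ} {G : ℤ → ℤ} (hG : G ∈ latticeConcave i j k)
    {c c' : ℤ} (hcc : c < c')
    (hc : c ∈ vertexSet i j G) (hc' : c' ∈ vertexSet i j G)
    (hno : ∀ b, c < b → b < c' → b ∉ vertexSet i j G) {b : ℤ} (hcb : c ≤ b) (hbc : b ≤ c') :
    G b = G c + (b - c) * (G c' - G c) / (c' - c) := by
  have h1 := le_chord_of_consecutive hcc hc hc' hno hcb hbc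
  have h2 : (c' - b) * G c + (b - c) * G c' < (c' - c) * (G b + 1) := by
    rcases hcb.eq_or_lt with rfl | h
    · nlinarith
    rcases hbc.eq_or_lt with rfl | h'
    · nlinarith
    exact hG.2.2.2 c b c' (mem_vertexSet.1 hc).1.1 h h' (mem_vertexSet.1 hc').1.2
  have h3 : (b - c) * (G c' - G c) / (c' - c) = G b - G c := by
    rw [Int.ediv_eq_iff_of_pos (by omega)]
    constructor <;> nlinarith
  rw [h3]; ring

theorem inf_mem_latticeConcave {i j k : ℤ} {K L : ℤ → ℤ} (hK : K ∈ latticeConcave i j k)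
    (hL : L ∈ latticeConcave i j k) : K ⊓ L ∈ latticeConcave i j k := by
  refine ⟨fun a ha => ?_, fun a ha => ?_, fun a ha => ?_, fun a b c h1 h2 h3 h4 => ?_⟩
  · simp [hK.1 a ha, hL.1 a ha]
  · simp [hK.2.1 a ha, hL.2.1 a ha]
  · exact inf_le_left.trans (hK.2.2.1 a ha)
  · have hK' := hK.2.2.2 a b c h1 h2 h3 h4
    have hL' := hL.2.2.2 a b c h1 h2 h3 h4
    simp only [Pi.inf_apply]
    have e1 : K a ⊓ L a ≤ K a := inf_le_left
    have e2 : K c ⊓ L c ≤ K c := inf_le_left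
    have e3 : K a ⊓ L a ≤ L a := inf_le_right
    have e4 : K c ⊓ L c ≤ L c := inf_le_right
    rcases le_total (K b) (L b) with h | h
    · rw [inf_eq_left.2 h]; nlinarith
    · rw [inf_eq_right.2 h]; nlinarith

theorem sub_single_mem_latticeConcave_iff {i j k : ℤ} {G : ℤ → ℤ}
    (hG : G ∈ latticeConcave i j k) {b : ℤ} (hib : i < b) (hbj : b < j) :
    G - Pi.single b 1 ∈ latticeConcave i j k ↔ IsStrictAt i j G b := by
  have hb : (G - Pi.single b 1 : ℤ → ℤ) b = G b - 1 := by simp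
  have hne : ∀ a, a ≠ b → (G - Pi.single b 1 : ℤ → ℤ) a = G a := fun a h => by simp [h]
  have hle : ∀ a, (G - Pi.single b 1 : ℤ → ℤ) a ≤ G a := fun a => by
    by_cases h : a = b
    · rw [h, hb]; omega
    · rw [hne a h]
  constructor
  · intro h a c h1 h2 h3 h4
    have := h.2.2.2 a b c h1 h2 h3 h4
    rw [hb, hne a (by omega), hne c (by omega)] at this
    simpa using this
  · intro h
    refine ⟨fun a ha => ?_, fun a ha => ?_, fun a ha => ?_, fun a x c h1 h2 h3 h4 => ?_⟩
    · rw [hne a (by omega)]; exact hG.1 a ha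
    · rw [hne a (by omega)]; exact hG.2.1 a ha
    · exact (hle a).trans (hG.2.2.1 a ha)
    · by_cases hx : x = b
      · subst hx
        rw [hb, hne a (by omega), hne c (by omega)]
        simpa using h a c h1 h2 h3 h4
      · rw [hne x hx]
        have := hG.2.2.2 a x c h1 h2 h3 h4
        have := hle a
        have := hle c
        nlinarith

theorem exists_sub_single_mem_latticeConcave {i j k : ℤ} (hij : i < j) {K L : ℤ → ℤ}
    (hK : K ∈ latticeConcave i j k) (hL : L ∈ latticeConcave i j k) (hle : K ≤ L) (hne : K ≠ L) :
    ∃ c ∈ Finset.Ioo i j, K c < L c ∧ L - Pi.single c 1 ∈ latticeConcave i j k := by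
  obtain ⟨b, hb⟩ := Function.ne_iff.1 hne
  have hib : i < b := by
    by_contra h
    exact hb (by rw [hK.1 b (by omega), hL.1 b (by omega)])
  have hbj : b < j := by
    by_contra h
    exact hb (by rw [hK.2.1 b (by omega), hL.2.1 b (by omega)])
  have hlt : K b < L b := lt_of_le_of_ne (hle b) hb
  by_contra hcon
  have heq : ∀ c ∈ vertexSet i j L, K c = L c := fun c hc => by
    by_contra hc'
    rw [mem_vertexSet] at hc
    have h1 : i < c := by
      by_contra h
      exact hc' (by rw [hK.1 c (by omega), hL.1 c (by omega)])
    have h2 : c < j := by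
      by_contra h
      exact hc' (by rw [hK.2.1 c (by omega), hL.2.1 c (by omega)])
    exact hcon ⟨c, Finset.mem_Ioo.2 ⟨h1, h2⟩, lt_of_le_of_ne (hle c) hc',
      (sub_single_mem_latticeConcave_iff hL h1 h2).2 hc.2⟩
  obtain ⟨c, c', hcb, hbc, hc, hc', hno⟩ := exists_consecutive hij L hib.le hbj
  have hcb' : c < b := lt_of_le_of_ne hcb fun h => hb (heq b (h ▸ hc))
  have h1 := le_chord_of_consecutive (hcb'.trans hbc) hc hc' hno hcb hbc.le
  have h2 := hK.2.2.2 c b c' (mem_vertexSet.1 hc).1.1 hcb' hbc (mem_vertexSet.1 hc').1.2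
  rw [heq c hc, heq c' hc'] at h2
  nlinarith

theorem finite_latticeConcave {i j k : ℤ} : (latticeConcave i j k).Finite := by
  refine Set.Finite.of_finite_image
    (f := fun (G : ℤ → ℤ) (a : Finset.Ioo i j) => G a) ?_ ?_
  · refine (Set.finite_Icc (fun _ => 0 : Finset.Ioo i j → ℤ) (fun _ => k - 1)).subset ?_
    rintro _ ⟨G, hG, rfl⟩
    refine ⟨fun a => ?_, fun a => ?_⟩ <;> obtain ⟨a, ha⟩ := a <;> rw [Finset.mem_Ioo] at ha
    · have h1 := hG.2.2.2 i a j le_rfl ha.1 ha.2 le_rfl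
      have h2 := hG.2.2.1 i (by omega)
      rw [hG.1 i le_rfl] at h1 h2
      rw [hG.2.1 j le_rfl] at h1
      by_contra h
      simp only [not_le] at h
      nlinarith
    · exact hG.2.2.1 a ha.2
  · intro G hG H hH h
    ext a
    rcases le_or_gt a i with h1 | h1
    · rw [hG.1 a h1, hH.1 a h1]
    rcases le_or_gt j a with h2 | h2
    · rw [hG.2.1 a h2, hH.2.1 a h2]
    exact congrFun h ⟨a, Finset.mem_Ioo.2 ⟨h1, h2⟩⟩

theorem max_mem_latticeConcave {i j k : ℤ} (hij : i < j) (hk : 1 ≤ k) :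
    (fun a => if a ≤ i then 0 else if a < j then k - 1 else k) ∈ latticeConcave i j k := by
  set E : ℤ → ℤ := fun a => if a ≤ i then 0 else if a < j then k - 1 else k with hE
  have h1 : ∀ a, a < j → E a ≤ k - 1 := fun a ha => by simp only [hE]; split_ifs <;> omega
  have h2 : ∀ a, E a ≤ k := fun a => by simp only [hE]; split_ifs <;> omega
  refine ⟨fun a ha => by simp [hE, ha], fun a ha => ?_, h1, fun a b c ha hab hbc hc => ?_⟩
  · simp only [hE]; split_ifs <;> omega
  · have hb : E b = k - 1 := by simp only [hE]; split_ifs <;> omega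
    rw [hb]
    nlinarith [h1 a (by omega), h2 c]

theorem le_max_of_mem_latticeConcave {i j k : ℤ} {G : ℤ → ℤ} (hG : G ∈ latticeConcave i j k) :
    G ≤ fun a => if a ≤ i then 0 else if a < j then k - 1 else k := fun a => by
  dsimp only
  split_ifs with h1 h2
  · exact (hG.1 a h1).le
  · exact hG.2.2.1 a h2
  · exact (hG.2.1 a (by omega)).le

/-- The integer height above `a` of the lattice path encoded by the chain `(t, c, kk)`. -/
def chainHeight (t : ℕ) (c kk : ℕ → ℤ) (a : ℤ) : ℤ :=
  ∑ s ∈ Finset.Icc 1 t, (min a (c (s - 1)) - min a (c s)) * kk s / (c (s - 1) - c s)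

section Chain

variable {i j k : ℤ} {t : ℕ} {c kk : ℕ → ℤ}

theorem ChainValid.antitone (h : ChainValid i j k (t, c, kk)) {m n : ℕ} (hmn : m ≤ n) :
    c n ≤ c m := by
  obtain ⟨-, -, ht, hlt, hge, -⟩ := h
  refine antitone_nat_of_succ_le (fun n => ?_) hmn
  rcases lt_or_ge n t with h' | h'
  · exact (hlt n h').le
  · exact ((hge (n + 1) (by dsimp only; omega)).trans (hge n h').symm).le

theorem ChainValid.strictAnti (h : ChainValid i j k (t, c, kk)) {m n : ℕ} (hmn : m < n)
    (hn : m < t) : c n < c m :=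
  (h.antitone hmn).trans_lt (h.2.2.2.1 m hn)

theorem ChainValid.step_pos (h : ChainValid i j k (t, c, kk)) {s : ℕ} (h1 : 1 ≤ s) (h2 : s ≤ t) :
    c s < c (s - 1) :=
  h.strictAnti (by omega) (by omega)

theorem ChainValid.height_segment (h : ChainValid i j k (t, c, kk)) {s : ℕ} (h1 : 1 ≤ s)
    (h2 : s ≤ t) {a : ℤ} (ha : c s ≤ a) (ha' : a ≤ c (s - 1)) :
    chainHeight t c kk a =
      chainHeight t c kk (c s) + (a - c s) * kk s / (c (s - 1) - c s) := by
  rw [← sub_eq_iff_eq_add', chainHeight, chainHeight, ← Finset.sum_sub_distrib,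
    Finset.sum_eq_single s]
  · have := h.step_pos h1 h2
    rw [min_eq_left ha', min_eq_right ha, min_eq_left this.le, min_self]
    simp
  · intro r hr hrs
    rw [Finset.mem_Icc] at hr
    have hr' := h.step_pos hr.1 hr.2
    rcases lt_or_gt_of_ne hrs with h' | h'
    · have : c (s - 1) ≤ c r := h.antitone (by omega)
      rw [min_eq_left (by omega), min_eq_left (by omega), min_eq_left (by omega),
        min_eq_left (by omega)]
      simp
    · have : c (r - 1) ≤ c s := h.antitone (by omega)
      rw [min_eq_right (by omega), min_eq_right (by omega), min_eq_right (by omega),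
        min_eq_right (by omega)]
      simp
  · intro hs
    exact absurd (Finset.mem_Icc.2 ⟨h1, h2⟩) hs

theorem ChainValid.height_pred (h : ChainValid i j k (t, c, kk)) {s : ℕ} (h1 : 1 ≤ s)
    (h2 : s ≤ t) :
    chainHeight t c kk (c (s - 1)) = chainHeight t c kk (c s) + kk s := by
  have := h.step_pos h1 h2
  rw [h.height_segment h1 h2 this.le le_rfl, Int.mul_ediv_cancel_left _ (by omega)]

theorem ChainValid.height_of_le (h : ChainValid i j k (t, c, kk)) {a : ℤ} (ha : a ≤ i) :
    chainHeight t c kk a = 0 := by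
  refine Finset.sum_eq_zero fun s hs => ?_
  rw [Finset.mem_Icc] at hs
  have h3 := h.step_pos hs.1 hs.2
  have h4 : c t ≤ c s := h.antitone hs.2
  have h5 : c t = i := h.2.2.1
  rw [min_eq_left (by omega), min_eq_left (by omega)]
  simp

theorem ChainValid.height_of_ge (h : ChainValid i j k (t, c, kk)) {a : ℤ} (ha : j ≤ a) :
    chainHeight t c kk a = k := by
  have hk : ∑ s ∈ Finset.Icc 1 t, kk s = k := h.2.2.2.2.2.2.2.2.1
  rw [← hk]
  refine Finset.sum_congr rfl fun s hs => ?_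
  rw [Finset.mem_Icc] at hs
  have h3 := h.step_pos hs.1 hs.2
  have h4 : c (s - 1) ≤ c 0 := h.antitone (by omega)
  have h5 : c 0 = j := h.2.1
  rw [min_eq_right (by omega), min_eq_right (by omega), Int.mul_ediv_cancel_left _ (by omega)]

theorem ChainValid.slope_step (h : ChainValid i j k (t, c, kk)) {s : ℕ} (h1 : 1 ≤ s)
    (h2 : s < t) : (kk s : ℚ) / ((c (s - 1) - c s : ℤ) : ℚ) <
      (kk (s + 1) : ℚ) / ((c s - c (s + 1) : ℤ) : ℚ) := by
  have h3 := h.2.2.2.2.2.2.2.2.2 s h1 h2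
  have k1 : (0 : ℚ) < (kk s : ℚ) := by
    exact_mod_cast Int.lt_of_add_one_le (h.2.2.2.2.2.1 s h1 h2.le)
  have k2 : (0 : ℚ) < (kk (s + 1) : ℚ) := by
    exact_mod_cast Int.lt_of_add_one_le (h.2.2.2.2.2.1 (s + 1) (by omega) h2)
  have d1 : (0 : ℚ) < ((c (s - 1) - c s : ℤ) : ℚ) := by
    exact_mod_cast sub_pos.2 (h.step_pos h1 h2.le)
  have d2 : (0 : ℚ) < ((c s - c (s + 1) : ℤ) : ℚ) := by
    exact_mod_cast sub_pos.2 (h.2.2.2.1 s h2)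
  dsimp only at h3
  rw [gt_iff_lt, div_lt_div_iff₀ k2 k1] at h3
  rw [div_lt_div_iff₀ d1 d2]
  linarith

theorem ChainValid.slope_mono (h : ChainValid i j k (t, c, kk)) {r s : ℕ} (h1 : 1 ≤ r)
    (hrs : r ≤ s) (h2 : s ≤ t) : (kk r : ℚ) / ((c (r - 1) - c r : ℤ) : ℚ) ≤
      (kk s : ℚ) / ((c (s - 1) - c s : ℤ) : ℚ) := by
  induction s, hrs using Nat.le_induction with
  | base => exact le_rfl
  | succ s hrs ih => exact (ih (by omega)).trans (h.slope_step (by omega) (by omega)).le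

theorem sum_Icc_pred_sub (f : ℕ → ℤ) (t : ℕ) :
    ∑ s ∈ Finset.Icc 1 t, (f (s - 1) - f s) = f 0 - f t := by
  induction t with
  | zero => simp
  | succ t ih => rw [Finset.sum_Icc_succ_top (by omega), ih]; simp

/-- The lattice path of a chain lies below the lines supporting its edges. -/
theorem ChainValid.height_le_line (h : ChainValid i j k (t, c, kk)) {s : ℕ} (h1 : 1 ≤ s)
    (h2 : s ≤ t) {a : ℤ} (ha : i ≤ a) (ha' : a ≤ j) :
    (c (s - 1) - c s) * (chainHeight t c kk a - chainHeight t c kk (c s)) ≤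
      (a - c s) * kk s := by
  have hs := h.step_pos h1 h2
  have hd : (0 : ℚ) < ((c (s - 1) - c s : ℤ) : ℚ) := by exact_mod_cast sub_pos.2 hs
  have hst : c t ≤ c s := h.antitone h2
  have hs0 : c s ≤ c 0 := h.antitone (by omega)
  have h0 : c 0 = j := h.2.1
  have ht : c t = i := h.2.2.1
  suffices hq : ((chainHeight t c kk a - chainHeight t c kk (c s) : ℤ) : ℚ) ≤
      ((a - c s : ℤ) : ℚ) * ((kk s : ℚ) / ((c (s - 1) - c s : ℤ) : ℚ)) by
    rw [← mul_div_assoc, le_div_iff₀ hd] at hq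
    rw [mul_comm]
    exact_mod_cast hq
  have key : (a - c s : ℤ) = ∑ r ∈ Finset.Icc 1 t,
      ((min a (c (r - 1)) - min a (c r)) - (min (c s) (c (r - 1)) - min (c s) (c r))) := by
    rw [Finset.sum_sub_distrib, sum_Icc_pred_sub (fun r => min a (c r)),
      sum_Icc_pred_sub (fun r => min (c s) (c r))]
    omega
  rw [key, chainHeight, chainHeight, ← Finset.sum_sub_distrib, Int.cast_sum, Int.cast_sum,
    Finset.sum_mul]
  refine Finset.sum_le_sum fun r hr => ?_
  rw [Finset.mem_Icc] at hr
  have hr' := h.step_pos hr.1 hr.2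
  have hdr : (0 : ℚ) < ((c (r - 1) - c r : ℤ) : ℚ) := by exact_mod_cast sub_pos.2 hr'
  have hfloor : ∀ x : ℤ, ((x * kk r / (c (r - 1) - c r) : ℤ) : ℚ) ≤
      (x : ℚ) * ((kk r : ℚ) / ((c (r - 1) - c r : ℤ) : ℚ)) := fun x => by
    rw [← mul_div_assoc, le_div_iff₀ hdr]
    exact_mod_cast Int.ediv_mul_le _ (by omega)
  rcases le_or_gt r s with hrs | hrs
  · have hcr : c s ≤ c r := h.antitone hrs
    rw [min_eq_left (show c s ≤ c (r - 1) by omega), min_eq_left hcr]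
    have hσ := h.slope_mono hr.1 hrs h2
    have hx : (0 : ℚ) ≤ ((min a (c (r - 1)) - min a (c r) : ℤ) : ℚ) := by
      exact_mod_cast (by omega : (0 : ℤ) ≤ min a (c (r - 1)) - min a (c r))
    simp only [sub_self, zero_mul, Int.zero_ediv, sub_zero]
    exact (hfloor _).trans (mul_le_mul_of_nonneg_left hσ hx)
  · have hcr : c (r - 1) ≤ c s := h.antitone (by omega)
    rw [min_eq_right hcr, min_eq_right (show c r ≤ c s by omega),
      Int.mul_ediv_cancel_left _ (by omega)]
    have hσ := h.slope_mono h1 hrs.le hr.2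
    have hx : ((min a (c (r - 1)) - min a (c r) - (c (r - 1) - c r) : ℤ) : ℚ) ≤ 0 := by
      exact_mod_cast (by omega : min a (c (r - 1)) - min a (c r) - (c (r - 1) - c r) ≤ 0)
    calc ((((min a (c (r - 1)) - min a (c r)) * kk r / (c (r - 1) - c r) - kk r : ℤ)) : ℚ)
        ≤ ((min a (c (r - 1)) - min a (c r) : ℤ) : ℚ) *
            ((kk r : ℚ) / ((c (r - 1) - c r : ℤ) : ℚ)) - kk r := by
          rw [Int.cast_sub]
          exact sub_le_sub_right (hfloor _) _
      _ = ((min a (c (r - 1)) - min a (c r) - (c (r - 1) - c r) : ℤ) : ℚ) *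
            ((kk r : ℚ) / ((c (r - 1) - c r : ℤ) : ℚ)) := by
          rw [Int.cast_sub _ (c (r - 1) - c r), sub_mul, mul_div_cancel₀ _ hdr.ne']
      _ ≤ _ := mul_le_mul_of_nonpos_left hσ hx

theorem ChainValid.exists_segment (h : ChainValid i j k (t, c, kk)) {a : ℤ} (ha : i ≤ a)
    (ha' : a < j) : ∃ s, 1 ≤ s ∧ s ≤ t ∧ c s ≤ a ∧ a < c (s - 1) := by
  have h0 : c 0 = j := h.2.1
  have ht : c t = i := h.2.2.1
  have hex : ∃ s, c s ≤ a := ⟨t, by omega⟩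
  classical
  refine ⟨Nat.find hex, ?_, Nat.find_min' hex (by omega), Nat.find_spec hex, ?_⟩
  · rw [Nat.one_le_iff_ne_zero]
    intro h'
    have := Nat.find_spec hex
    rw [h'] at this
    omega
  · have h1 : Nat.find hex ≠ 0 := fun h' => by
      have := Nat.find_spec hex
      rw [h'] at this
      omega
    exact not_le.1 (Nat.find_min hex (by omega : Nat.find hex - 1 < Nat.find hex))

theorem ChainValid.height_mem_latticeConcave (h : ChainValid i j k (t, c, kk)) :
    chainHeight t c kk ∈ latticeConcave i j k := by
  have hk : ∑ s ∈ Finset.Icc 1 t, kk s = k := h.2.2.2.2.2.2.2.2.1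
  have hkpos : ∀ s, 1 ≤ s → s ≤ t → 1 ≤ kk s := h.2.2.2.2.2.1
  have h0 : c 0 = j := h.2.1
  have ht1 : 1 ≤ t := h.1
  refine ⟨fun a => h.height_of_le, fun a => h.height_of_ge, fun a ha => ?_,
    fun a b e h1 h2 h3 h4 => ?_⟩
  · rcases le_or_gt a i with hai | hai
    · rw [h.height_of_le hai, ← hk]
      have : kk 1 ≤ ∑ s ∈ Finset.Icc 1 t, kk s :=
        Finset.single_le_sum (fun s hs => by
          rw [Finset.mem_Icc] at hs
          linarith [hkpos s hs.1 hs.2]) (Finset.mem_Icc.2 ⟨le_rfl, ht1⟩)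
      linarith [hkpos 1 le_rfl ht1]
    · have h5 := h.height_le_line le_rfl ht1 hai.le ha.le
      have h6 := h.height_pred le_rfl ht1
      have h7 := h.step_pos le_rfl ht1
      simp only [Nat.sub_self, h0] at h5 h6 h7
      rw [h.height_of_ge le_rfl] at h6
      have h8 := hkpos 1 le_rfl ht1
      by_contra hcon
      nlinarith
  · obtain ⟨s, hs1, hs2, hs3, hs4⟩ := h.exists_segment (a := b) (by omega) (by omega)
    have l1 := h.height_le_line hs1 hs2 (a := a) (by omega) (by omega)
    have l2 := h.height_le_line hs1 hs2 (a := e) (by omega) (by omega)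
    have l3 := h.height_segment hs1 hs2 hs3 hs4.le
    have hd := h.step_pos hs1 hs2
    have l4 := Int.lt_ediv_add_one_mul_self ((b - c s) * kk s) (sub_pos.2 hd)
    rw [show (b - c s) * kk s / (c (s - 1) - c s) =
      chainHeight t c kk b - chainHeight t c kk (c s) by rw [l3]; ring] at l4
    refine lt_of_mul_lt_mul_left (a := c (s - 1) - c s) ?_ (by omega)
    have m1 := mul_le_mul_of_nonneg_left l1 (by omega : 0 ≤ e - b)
    have m2 := mul_le_mul_of_nonneg_left l2 (by omega : 0 ≤ b - a)
    have m3 := mul_lt_mul_of_pos_left l4 (by omega : 0 < e - a)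
    linarith

theorem ChainValid.vertexSet_height (h : ChainValid i j k (t, c, kk)) :
    vertexSet i j (chainHeight t c kk) = (Finset.range (t + 1)).image c := by
  have h0 : c 0 = j := h.2.1
  have ht : c t = i := h.2.2.1
  have hij : i < j := by
    rw [← h0, ← ht]; exact h.strictAnti h.1 h.1
  ext b
  simp only [Finset.mem_image, Finset.mem_range]
  constructor
  · intro hb
    rw [mem_vertexSet] at hb
    rcases hb.1.2.eq_or_lt with rfl | hbj
    · exact ⟨0, by omega, h0⟩
    obtain ⟨s, hs1, hs2, hs3, hs4⟩ := h.exists_segment hb.1.1 hbj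
    refine ⟨s, by omega, ?_⟩
    by_contra hne
    have hst : c t ≤ c s := h.antitone hs2
    have hs0 : c (s - 1) ≤ c 0 := h.antitone (by omega)
    have h1 := hb.2 (c s) (c (s - 1)) (by omega) (lt_of_le_of_ne hs3 hne) hs4 (by omega)
    have h2 := h.height_le_line hs1 hs2 hb.1.1 hb.1.2
    rw [h.height_pred hs1 hs2] at h1
    linarith
  · rintro ⟨s, hs, rfl⟩
    have hst : c t ≤ c s := h.antitone (by omega)
    have hs0 : c s ≤ c 0 := h.antitone (by omega)
    refine mem_vertexSet.2 ⟨⟨by omega, by omega⟩, fun a e h1 h2 h3 h4 => ?_⟩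
    have hs1 : 1 ≤ s := by
      by_contra hs1
      obtain rfl : s = 0 := by omega
      omega
    have hst' : s < t := by
      by_contra hs1
      obtain rfl : s = t := by omega
      omega
    have l1 := h.height_le_line (s := s + 1) (by omega) hst' (a := a) (by omega) (by omega)
    have l2 := h.height_le_line hs1 hst'.le (a := e) (by omega) (by omega)
    have l3 := h.height_pred (s := s + 1) (by omega) hst'
    have d1 := h.step_pos hs1 hst'.le
    have d2 := h.step_pos (s := s + 1) (by omega) hst'
    have hσ := h.slope_step hs1 hst'
    rw [div_lt_div_iff₀ (by exact_mod_cast sub_pos.2 d1) (by exact_mod_cast sub_pos.2 d2)] at hσ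
    norm_cast at hσ
    simp only [Nat.add_sub_cancel] at l1 l3 d2
    set H := chainHeight t c kk
    have l1' : (c s - c (s + 1)) * (H a - H (c s)) ≤ (a - c s) * kk (s + 1) := by
      rw [l3]; linarith
    have hd1 : 0 < c (s - 1) - c s := by omega
    have hd2 : 0 < c s - c (s + 1) := by omega
    refine lt_of_mul_lt_mul_left (a := (c (s - 1) - c s) * (c s - c (s + 1))) ?_ (by positivity)
    have m1 := mul_le_mul_of_nonneg_left l1'
      (mul_nonneg hd1.le (by omega : 0 ≤ e - c s))
    have m2 := mul_le_mul_of_nonneg_left l2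
      (mul_nonneg hd2.le (by omega : 0 ≤ c s - a))
    have m3 := mul_lt_mul_of_pos_left hσ
      (mul_pos (by omega : 0 < e - c s) (by omega : 0 < c s - a))
    linarith

end Chain

theorem exists_strictAnti_enumeration (V : Finset ℤ) (i : ℤ) (hi : i ∈ V) (hV : ∀ x ∈ V, i ≤ x) :
    ∃ (t : ℕ) (c : ℕ → ℤ), (∀ s, s < t → c (s + 1) < c s) ∧ (∀ s, t ≤ s → c s = i) ∧
      V = (Finset.range (t + 1)).image c := by
  induction V using Finset.induction_on_max with
  | empty => simp at hi
  | insert a S ha ih =>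
    rcases S.eq_empty_or_nonempty with rfl | ⟨x, hx⟩
    · obtain rfl : i = a := by simpa using hi
      exact ⟨0, fun _ => i, by simp, by simp, by simp⟩
    · have hiS : i ∈ S := by
        rcases Finset.mem_insert.1 hi with rfl | h
        · have := hV x (by simp [hx])
          have := ha x hx
          omega
        · exact h
      obtain ⟨t, c, h1, h2, h3⟩ := ih hiS fun x hx => hV x (by simp [hx])
      refine ⟨t + 1, fun n => n.casesOn a c, fun s hs => ?_, fun s hs => ?_, ?_⟩
      · cases s with
        | zero => exact ha _ (h3 ▸ Finset.mem_image_of_mem c (by simp))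
        | succ s => exact h1 s (by omega)
      · cases s with
        | zero => omega
        | succ s => exact h2 s (by omega)
      · rw [Finset.range_eq_Ico, ← Finset.insert_Ico_add_one_left_eq_Ico (by omega),
          Finset.image_insert, h3]
        congr 1
        ext y
        simp only [Finset.mem_image, Finset.mem_range, Finset.mem_Ico]
        constructor
        · rintro ⟨s, hs, rfl⟩
          exact ⟨s + 1, by omega, rfl⟩
        · rintro ⟨s, hs, rfl⟩
          cases s with
          | zero => omega
          | succ s => exact ⟨s, by omega, rfl⟩

theorem ChainValid.injOn_range {i j k : ℤ} {t : ℕ} {c kk : ℕ → ℤ}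
    (h : ChainValid i j k (t, c, kk)) : Set.InjOn c (Finset.range (t + 1)) := by
  intro m hm n hn hmn
  simp only [Finset.coe_range, Set.mem_Iio] at hm hn
  rcases lt_trichotomy m n with h' | h' | h'
  · have := h.strictAnti h' (by omega); omega
  · exact h'
  · have := h.strictAnti h' (by omega); omega

theorem injOn_chainHeight (i j k : ℤ) :
    Set.InjOn (fun D : ℕ × (ℕ → ℤ) × (ℕ → ℤ) => chainHeight D.1 D.2.1 D.2.2)
      {D | ChainValid i j k D} := by
  rintro ⟨t, c, kk⟩ h ⟨t', c', kk'⟩ h' heq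
  dsimp only at heq
  have hV := h.vertexSet_height
  rw [heq, h'.vertexSet_height] at hV
  have hcard := congrArg Finset.card hV
  rw [Finset.card_image_of_injOn h.injOn_range, Finset.card_image_of_injOn h'.injOn_range,
    Finset.card_range, Finset.card_range] at hcard
  obtain rfl : t' = t := by omega
  have hc : c = c' := by
    have hmono : ∀ {c kk : ℕ → ℤ}, ChainValid i j k (t', c, kk) →
        StrictMono fun s : Fin (t' + 1) => OrderDual.toDual (c s) := fun h a b hab =>
      h.strictAnti hab (by omega)
    have hrange : Set.range (fun s : Fin (t' + 1) => OrderDual.toDual (c s)) =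
        Set.range (fun s : Fin (t' + 1) => OrderDual.toDual (c' s)) := by
      have hr : ∀ c : ℕ → ℤ, Set.range (fun s : Fin (t' + 1) => OrderDual.toDual (c s)) =
          {x | OrderDual.ofDual x ∈ (Finset.range (t' + 1)).image c} := fun c => by
        ext x
        simp only [Set.mem_range, Set.mem_ofPred_eq, Finset.mem_image, Finset.mem_range]
        exact ⟨fun ⟨s, hs⟩ => ⟨s, s.2, congrArg OrderDual.ofDual hs⟩,
          fun ⟨s, hs, hx⟩ => ⟨⟨s, hs⟩, congrArg OrderDual.toDual hx⟩⟩
      rw [hr, hr, hV]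
    have hfun := ((hmono h).range_inj (hmono h')).1 hrange
    ext s
    rcases lt_or_ge s (t' + 1) with hs | hs
    · exact congrArg OrderDual.ofDual (congrFun hfun ⟨s, hs⟩)
    · exact (h.2.2.2.2.1 s (by dsimp only; omega)).trans
        (h'.2.2.2.2.1 s (by dsimp only; omega)).symm
  subst hc
  have hkk : kk = kk' := by
    ext s
    rcases Nat.eq_zero_or_pos s with rfl | hs
    · exact h.2.2.2.2.2.2.1.trans h'.2.2.2.2.2.2.1.symm
    rcases le_or_gt s t' with hst | hst
    · have e1 := h.height_pred hs hst
      have e2 := h'.height_pred hs hst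
      rw [heq] at e1
      linarith
    · exact (h.2.2.2.2.2.2.2.1 s hst).trans (h'.2.2.2.2.2.2.2.1 s hst).symm
  rw [hkk]

theorem exists_chainHeight_eq {i j k : ℤ} (hij : i < j) {G : ℤ → ℤ}
    (hG : G ∈ latticeConcave i j k) :
    ∃ t c kk, ChainValid i j k (t, c, kk) ∧ chainHeight t c kk = G := by
  obtain ⟨t, c, hlt, hge, hV⟩ := exists_strictAnti_enumeration (vertexSet i j G) i
    (left_mem_vertexSet hij G) fun x hx => (mem_vertexSet.1 hx).1.1
  have hanti : Antitone c := antitone_nat_of_succ_le fun n => by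
    rcases lt_or_ge n t with h' | h'
    · exact (hlt n h').le
    · exact ((hge (n + 1) (by omega)).trans (hge n h').symm).le
  have ht : c t = i := hge t le_rfl
  have hmem : ∀ s, s ≤ t → c s ∈ vertexSet i j G := fun s hs => by
    rw [hV]; exact Finset.mem_image_of_mem c (by simp; omega)
  have h0 : c 0 = j := by
    have hj := right_mem_vertexSet hij G
    rw [hV, Finset.mem_image] at hj
    obtain ⟨s, -, hs⟩ := hj
    have h1 : c s ≤ c 0 := hanti (Nat.zero_le s)
    have h2 := (mem_vertexSet.1 (hmem 0 (Nat.zero_le t))).1.2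
    omega
  have ht1 : 1 ≤ t := by
    by_contra h
    obtain rfl : t = 0 := by omega
    omega
  have hno : ∀ s, 1 ≤ s → s ≤ t → ∀ b, c s < b → b < c (s - 1) → b ∉ vertexSet i j G := by
    intro s h1 h2 b hb hb' hmem
    rw [hV, Finset.mem_image] at hmem
    obtain ⟨r, -, rfl⟩ := hmem
    rcases le_or_gt s r with hsr | hsr
    · exact absurd (hanti hsr) (not_le.2 hb)
    · exact absurd (hanti (show r ≤ s - 1 by omega)) (not_le.2 hb')
  have hstep : ∀ s, 1 ≤ s → s ≤ t → c s < c (s - 1) := fun s h1 h2 => by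
    have := hlt (s - 1) (by omega)
    rwa [Nat.sub_add_cancel h1] at this
  have hslope : ∀ s, 1 ≤ s → s < t → (G (c (s - 1)) - G (c s)) * (c s - c (s + 1)) <
      (G (c s) - G (c (s + 1))) * (c (s - 1) - c s) := fun s h1 h2 => by
    have h3 := (mem_vertexSet.1 (hmem s h2.le)).2 (c (s + 1)) (c (s - 1))
      (mem_vertexSet.1 (hmem _ h2)).1.1 (hlt s h2) (hstep s h1 h2.le)
      (mem_vertexSet.1 (hmem _ (by omega))).1.2
    linarith
  have hpos : ∀ s, 1 ≤ s → s ≤ t → 1 ≤ G (c (s - 1)) - G (c s) := fun s h1 => by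
    induction s, h1 using Nat.le_induction with
    | base =>
      intro h2
      have := hstep 1 le_rfl h2
      simp only [Nat.sub_self, h0] at this ⊢
      have := hG.2.2.1 (c 1) this
      rw [hG.2.1 j le_rfl]
      omega
    | succ s h1 ih =>
      intro h2
      have h3 := ih (by omega)
      have h4 := hslope s h1 h2
      have h5 := hstep s h1 (by omega)
      have h6 := hlt s h2
      simp only [Nat.add_sub_cancel]
      by_contra hcon
      nlinarith
  set kk : ℕ → ℤ := fun s => if 1 ≤ s ∧ s ≤ t then G (c (s - 1)) - G (c s) else 0 with hkk
  have hkk' : ∀ s, 1 ≤ s → s ≤ t → kk s = G (c (s - 1)) - G (c s) := fun s h1 h2 => by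
    simp [hkk, h1, h2]
  have hvalid : ChainValid i j k (t, c, kk) := by
    refine ⟨ht1, h0, ht, hlt, hge, fun s h1 h2 => ?_, by simp [hkk], fun s hs => ?_, ?_,
      fun s h1 h2 => ?_⟩
    · dsimp only
      rw [hkk' s h1 h2]; exact hpos s h1 h2
    · dsimp only at hs
      simp only [hkk]
      rw [if_neg (by omega)]
    · dsimp only
      rw [Finset.sum_congr rfl fun s hs => hkk' s (Finset.mem_Icc.1 hs).1 (Finset.mem_Icc.1 hs).2,
        sum_Icc_pred_sub fun s => G (c s), ht, h0, hG.1 i le_rfl, hG.2.1 j le_rfl, sub_zero]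
    · dsimp only at h2 ⊢
      have p1 := hpos s h1 h2.le
      have p2 := hpos (s + 1) (by omega) h2
      rw [hkk' s h1 h2.le, hkk' (s + 1) (by omega) h2, gt_iff_lt,
        div_lt_div_iff₀ (by exact_mod_cast p2) (by exact_mod_cast p1)]
      have := hslope s h1 h2
      simp only [Nat.add_sub_cancel]
      rw [mul_comm, mul_comm ((c (s - 1) - c s : ℤ) : ℚ)]
      exact_mod_cast this
  refine ⟨t, c, kk, hvalid, ?_⟩
  have hvert : ∀ m, m ≤ t → chainHeight t c kk (c (t - m)) = G (c (t - m)) := fun m => by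
    induction m with
    | zero =>
      intro _
      rw [Nat.sub_zero, ht, hvalid.height_of_le le_rfl, hG.1 i le_rfl]
    | succ m ih =>
      intro hm
      have h1 := hvalid.height_pred (s := t - m) (by omega) (by omega)
      rw [ih (by omega), hkk' (t - m) (by omega) (by omega)] at h1
      rw [show t - (m + 1) = t - m - 1 by omega, h1]
      ring
  ext a
  rcases le_or_gt a i with hai | hai
  · rw [hvalid.height_of_le hai, hG.1 a hai]
  rcases le_or_gt j a with haj | haj
  · rw [hvalid.height_of_ge haj, hG.2.1 a haj]
  obtain ⟨s, h1, h2, h3, h4⟩ := hvalid.exists_segment hai.le haj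
  have h5 := hvert (t - s) (by omega)
  rw [show t - (t - s) = s by omega] at h5
  rw [hvalid.height_segment h1 h2 h3 h4.le, h5, hkk' s h1 h2]
  exact (eq_add_ediv_of_consecutive hG (hstep s h1 h2) (hmem s h2) (hmem (s - 1) (by omega))
    (hno s h1 h2) h3 h4.le).symm

theorem bijOn_chainHeight {i j k : ℤ} (hij : i < j) :
    Set.BijOn (fun D : ℕ × (ℕ → ℤ) × (ℕ → ℤ) => chainHeight D.1 D.2.1 D.2.2)
      {D | ChainValid i j k D} (latticeConcave i j k) :=
  ⟨fun ⟨_, _, _⟩ h => h.height_mem_latticeConcave, injOn_chainHeight i j k, fun G hG => by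
    obtain ⟨t, c, kk, h, rfl⟩ := exists_chainHeight_eq hij hG
    exact ⟨(t, c, kk), h, rfl⟩⟩

theorem prod_Icc_prod_Ico {M : Type*} [CommMonoid M] (f : ℤ → M) {c : ℕ → ℤ} {t : ℕ}
    (hc : ∀ s, s < t → c (s + 1) < c s) :
    ∏ s ∈ Finset.Icc 1 t, ∏ a ∈ Finset.Ico (c s) (c (s - 1)), f a =
      ∏ a ∈ Finset.Ico (c t) (c 0), f a := by
  induction t with
  | zero => simp
  | succ t ih =>
    have hle : ∀ n, n ≤ t → c n ≤ c 0 := fun n => by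
      induction n with
      | zero => simp
      | succ n ihn => intro hn; linarith [ihn (by omega), hc n (by omega)]
    rw [Finset.prod_Icc_succ_top (by omega), ih fun s hs => hc s (by omega), Nat.add_sub_cancel,
      mul_comm, ← Finset.prod_union (Finset.Ico_disjoint_Ico_consecutive _ _ _),
      Finset.Ico_union_Ico_eq_Ico (hc t (by omega)).le (hle t le_rfl)]

/-- Summation by parts, in multiplicative form. -/
theorem prod_Ico_zpow_sub {R : Type*} [Field R] (w : ℤ → R) (H : ℤ → ℤ) (i : ℤ) {m : ℤ}
    (hm : i + 1 ≤ m) (hw : ∀ a, i ≤ a → a < m → w a ≠ 0) :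
    ∏ a ∈ Finset.Ico i m, w a ^ (H (a + 1) - H a) =
      w (m - 1) ^ H m * w i ^ (-H i) * ∏ a ∈ Finset.Ioo i m, (w (a - 1) / w a) ^ H a := by
  induction m, hm using Int.leInduction with
  | base =>
    have h1 : Finset.Ico i (i + 1) = {i} := by ext; simp; omega
    have h2 : Finset.Ioo i (i + 1) = ∅ := by ext; simp
    rw [h1, h2, Finset.prod_singleton, Finset.prod_empty, mul_one, add_sub_cancel_right,
      ← zpow_add₀ (hw i le_rfl (by omega)), sub_eq_add_neg]
  | succ m hm ih =>
    have h1 : Finset.Ico i (m + 1) = insert m (Finset.Ico i m) := by ext; simp; omega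
    have h2 : Finset.Ioo i (m + 1) = insert m (Finset.Ioo i m) := by ext; simp; omega
    have hm0 := hw m (by omega) (by omega)
    rw [h1, h2, Finset.prod_insert (by simp), Finset.prod_insert (by simp),
      ih fun a h3 h4 => hw a h3 (by omega), add_sub_cancel_right, zpow_sub₀ hm0, div_zpow]
    field_simp

theorem zpow_sum_eq_prod {ι R : Type*} [Field R] {x : R} (hx : x ≠ 0) (S : Finset ι) (f : ι → ℤ) :
    x ^ ∑ a ∈ S, f a = ∏ a ∈ S, x ^ f a := by
  classical
  induction S using Finset.induction_on with
  | empty => simp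
  | insert a S ha ih => rw [Finset.sum_insert ha, Finset.prod_insert ha, zpow_add₀ hx, ih]

theorem ChainValid.alphaV_eq {i j k : ℤ} {t : ℕ} {c kk : ℕ → ℤ}
    (h : ChainValid i j k (t, c, kk)) :
    alphaV c kk t = ∑ a ∈ Finset.Ioo i j, chainHeight t c kk a := by
  have h0 : c 0 = j := h.2.1
  have ht : c t = i := h.2.2.1
  have hij : i < j := by
    rw [← h0, ← ht]; exact h.strictAnti h.1 h.1
  have key : ∀ n, n ≤ t → alphaV c kk n = ∑ a ∈ Finset.Ico (c n) (c 0), chainHeight t c kk a -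
      chainHeight t c kk (c n) * (c 0 - c n) := fun n => by
    induction n with
    | zero => simp [alphaV]
    | succ n ih =>
      intro hn
      have hd := h.step_pos (s := n + 1) (by omega) hn
      have hkk : 1 ≤ kk (n + 1) := h.2.2.2.2.2.1 (n + 1) (by omega) hn
      have hp := h.height_pred (s := n + 1) (by omega) hn
      have hseg : ∑ a ∈ Finset.Ico (c (n + 1)) (c n), chainHeight t c kk a =
          (c n - c (n + 1)) * chainHeight t c kk (c (n + 1)) +
          (kk (n + 1) * (c n - c (n + 1)) - kk (n + 1) - (c n - c (n + 1))
            + (Int.gcd (c n - c (n + 1)) (kk (n + 1)) : ℤ)) / 2 := by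
        simp only [Nat.add_sub_cancel] at hd hp
        rw [← sum_Ico_mul_ediv _ _ (by omega) (by omega)]
        have e1 : ∑ a ∈ Finset.Ico (c (n + 1)) (c n), chainHeight t c kk a =
            ∑ a ∈ Finset.Ico (c (n + 1)) (c n), (chainHeight t c kk (c (n + 1)) +
              (a - c (n + 1)) * kk (n + 1) / (c n - c (n + 1))) :=
          Finset.sum_congr rfl fun a ha => by
            rw [Finset.mem_Ico] at ha
            exact h.height_segment (s := n + 1) (by omega) hn ha.1 ha.2.le
        rw [e1, Finset.sum_add_distrib, Finset.sum_const, Int.card_Ico, nsmul_eq_mul,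
          Int.toNat_of_nonneg (by omega)]
        congr 1
        refine Finset.sum_nbij' (fun a => a - c (n + 1)) (fun a => a + c (n + 1))
          ?_ ?_ ?_ ?_ ?_ <;>
          simp only [Finset.mem_Ico] <;> intros <;> first | omega | trivial
      have hle : c n ≤ c 0 := h.antitone (Nat.zero_le n)
      simp only [Nat.add_sub_cancel] at hd hp
      rw [alphaV, Finset.sum_Icc_succ_top (by omega), ← alphaV, ih (by omega),
        ← Finset.Ico_union_Ico_eq_Ico hd.le hle,
        Finset.sum_union (Finset.Ico_disjoint_Ico_consecutive _ _ _), hseg]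
      simp only [Nat.add_sub_cancel]
      rw [hp]
      ring
  rw [key t le_rfl, ht, h0, h.height_of_le le_rfl, zero_mul, sub_zero,
    ← Finset.sum_Ioo_add_eq_sum_Ico hij, h.height_of_le le_rfl, add_zero]

theorem algebraMap_X_ne_zero_s12 {i j : ℤ} (x : Vars i j) :
    algebraMap (MvPolynomial (Vars i j) ℚ) (F i j) (X x) ≠ 0 := by
  rw [Ne, FaithfulSMul.algebraMap_eq_zero_iff]
  exact X_ne_zero x

theorem qF_ne_zero (i j : ℤ) : qF i j ≠ 0 := algebraMap_X_ne_zero_s12 _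

theorem uF_ne_zero (i j : ℤ) : uF i j ≠ 0 := algebraMap_X_ne_zero_s12 _

theorem zF_ne_zero {i j a : ℤ} (h1 : i ≤ a) (h2 : a < j) : zF i j a ≠ 0 := by
  rw [zF, dif_pos ⟨h1, by omega⟩]
  exact algebraMap_X_ne_zero_s12 _

open Classical in
/-- The summand of a chain in terms of its lattice path. -/
theorem ChainValid.chainTerm_eq {i j k : ℤ} {t : ℕ} {c kk : ℕ → ℤ}
    (h : ChainValid i j k (t, c, kk)) :
    ChainTerm i j k (t, c, kk) =
      (qF i j ^ 2 * uF i j) ^ (k - (k - 1) * (j - i)) * (-(qF i j ^ 2 * uF i j)) ^ (i - j) *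
        (zF i j (j - 1) * uF i j ^ (j - 1)) ^ k *
      ((∏ a ∈ Finset.Ioo i j,
          (zF i j (a - 1) * qF i j ^ 2 / zF i j a) ^ chainHeight t c kk a) *
        ∏ a ∈ Finset.Ioo i j with chainHeight t c kk - Pi.single a 1 ∈ latticeConcave i j k,
          (1 - (zF i j (a - 1) * qF i j ^ 2 / zF i j a)⁻¹)) := by
  have h0 : c 0 = j := h.2.1
  have ht : c t = i := h.2.2.1
  have hij : i < j := by
    rw [← h0, ← ht]; exact h.strictAnti h.1 h.1
  have hq := qF_ne_zero i j
  have hu := uF_ne_zero i j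
  have hP : qF i j ^ 2 * uF i j ≠ 0 := mul_ne_zero (pow_ne_zero _ hq) hu
  have hfilter : ((Finset.Ioo i j).filter fun a =>
      chainHeight t c kk - Pi.single a 1 ∈ latticeConcave i j k) =
        (Finset.Icc 1 (t - 1)).image c := by
    ext a
    simp only [Finset.mem_filter, Finset.mem_Ioo, Finset.mem_image, Finset.mem_Icc]
    constructor
    · rintro ⟨ha, hmem⟩
      rw [sub_single_mem_latticeConcave_iff h.height_mem_latticeConcave ha.1 ha.2] at hmem
      have hv : a ∈ vertexSet i j (chainHeight t c kk) :=
        mem_vertexSet.2 ⟨⟨ha.1.le, ha.2.le⟩, hmem⟩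
      rw [h.vertexSet_height, Finset.mem_image] at hv
      obtain ⟨s, hs, rfl⟩ := hv
      rw [Finset.mem_range] at hs
      have h1 : s ≠ 0 := by rintro rfl; omega
      have h2 : s ≠ t := by rintro rfl; omega
      exact ⟨s, by omega, rfl⟩
    · rintro ⟨s, hs, rfl⟩
      have h1 : c t < c s := h.strictAnti (by omega) (by omega)
      have h2 : c s < c 0 := h.strictAnti (by omega) (by omega)
      have hv : c s ∈ vertexSet i j (chainHeight t c kk) := by
        rw [h.vertexSet_height]
        exact Finset.mem_image_of_mem c (by simp; omega)
      rw [sub_single_mem_latticeConcave_iff h.height_mem_latticeConcave (by omega) (by omega)]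
      exact ⟨by omega, (mem_vertexSet.1 hv).2⟩
  have hvert : ∏ s ∈ Finset.Icc 1 (t - 1), (1 - zF i j (c s) / (zF i j (c s - 1) * qF i j ^ 2)) =
      ∏ a ∈ Finset.Ioo i j with chainHeight t c kk - Pi.single a 1 ∈ latticeConcave i j k,
          (1 - (zF i j (a - 1) * qF i j ^ 2 / zF i j a)⁻¹) := by
    rw [hfilter, Finset.prod_image (h.injOn_range.mono fun s hs => by
      simp only [Finset.coe_Icc, Set.mem_Icc, Finset.coe_range, Set.mem_Iio] at hs ⊢; omega)]
    exact Finset.prod_congr rfl fun s _ => by rw [inv_div]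
  have hmono : ∏ s ∈ Finset.Icc 1 t, ∏ a ∈ Finset.Icc (c s) (c (s - 1) - 1),
      (zF i j a * uF i j ^ a) ^
        ((a - c s + 1) * kk s / (c (s - 1) - c s) - (a - c s) * kk s / (c (s - 1) - c s)) =
      ∏ a ∈ Finset.Ico i j, (zF i j a * uF i j ^ a) ^
        (chainHeight t c kk (a + 1) - chainHeight t c kk a) := by
    have hlt : ∀ s, s < t → c (s + 1) < c s := h.2.2.2.1
    rw [← h0, ← ht, ← prod_Icc_prod_Ico _ hlt]
    refine Finset.prod_congr rfl fun s hs => ?_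
    rw [Finset.mem_Icc] at hs
    refine Finset.prod_congr (by ext; simp) fun a ha => ?_
    rw [Finset.mem_Ico] at ha
    rw [h.height_segment hs.1 hs.2 (a := a + 1) (by omega) (by omega),
      h.height_segment hs.1 hs.2 ha.1 ha.2.le, add_sub_add_left_eq_sub, add_sub_right_comm]
  have hw : ∀ a, i ≤ a → a < j → zF i j a * uF i j ^ a ≠ 0 := fun a h1 h2 =>
    mul_ne_zero (zF_ne_zero h1 h2) (zpow_ne_zero _ hu)
  have hmain : (qF i j ^ 2 * uF i j) ^ alphaV c kk t *
      ∏ a ∈ Finset.Ico i j, (zF i j a * uF i j ^ a) ^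
        (chainHeight t c kk (a + 1) - chainHeight t c kk a) =
      (zF i j (j - 1) * uF i j ^ (j - 1)) ^ k * ∏ a ∈ Finset.Ioo i j,
          (zF i j (a - 1) * qF i j ^ 2 / zF i j a) ^ chainHeight t c kk a := by
    rw [prod_Ico_zpow_sub (fun a => zF i j a * uF i j ^ a) _ i (by omega) hw,
      h.height_of_ge le_rfl, h.height_of_le le_rfl, h.alphaV_eq, zpow_sum_eq_prod hP,
      neg_zero, zpow_zero, mul_one, mul_left_comm, ← Finset.prod_mul_distrib]
    congr 1
    refine Finset.prod_congr rfl fun a ha => ?_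
    rw [Finset.mem_Ioo] at ha
    have hz := zF_ne_zero ha.1.le ha.2
    rw [← mul_zpow, zpow_sub_one₀ hu]
    congr 1
    have := zpow_ne_zero a hu
    field_simp
  unfold ChainTerm
  dsimp only
  rw [hvert, hmono, show alphaV c kk t - (k - 1) * (j - i) + k =
    k - (k - 1) * (j - i) + alphaV c kk t by ring, zpow_add₀ hP]
  linear_combination (qF i j ^ 2 * uF i j) ^ (k - (k - 1) * (j - i)) *
    (-(qF i j ^ 2 * uF i j)) ^ (i - j) *
    (∏ a ∈ Finset.Ioo i j with chainHeight t c kk - Pi.single a 1 ∈ latticeConcave i j k,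
          (1 - (zF i j (a - 1) * qF i j ^ 2 / zF i j a)⁻¹)) * hmain

/-- The identity: the sum over all chain data of the weighted products equals
`(z_i u^i)^k · (−z_{j−1}) / (z_i (−q²)^{j−i−1})`. -/
theorem chain_sum_identity (i j : ℤ) (hij : i < j) (k : ℤ) (hk : 1 ≤ k)
    (n : ℤ) (hn : 1 ≤ n) :
    (∑ᶠ D ∈ {D : ℕ × (ℕ → ℤ) × (ℕ → ℤ) | ChainValid i j k D},
        ChainTerm i j k D)
      = (zF i j i * uF i j ^ i) ^ k * (-(zF i j (j - 1))) /
          (zF i j i * (-(qF i j ^ 2)) ^ (j - i - 1)) := by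
  classical
  have hq := qF_ne_zero i j
  have hu := uF_ne_zero i j
  have hP : qF i j ^ 2 * uF i j ≠ 0 := mul_ne_zero (pow_ne_zero _ hq) hu
  have hw : ∀ a, i ≤ a → a < j → zF i j a * uF i j ^ a ≠ 0 := fun a h1 h2 =>
    mul_ne_zero (zF_ne_zero h1 h2) (zpow_ne_zero _ hu)
  have hfin : (latticeConcave i j k).Finite := finite_latticeConcave
  have hsum := sum_prod_zpow_mul_prod_one_sub_inv (Finset.Ioo i j)
    (fun a => zF i j (a - 1) * qF i j ^ 2 / zF i j a)
    (fun a ha => by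
      rw [Finset.mem_Ioo] at ha
      exact div_ne_zero (mul_ne_zero (zF_ne_zero (by omega) (by omega)) (pow_ne_zero _ hq))
        (zF_ne_zero ha.1.le ha.2))
    hfin.toFinset (fun a => if a ≤ i then 0 else if a < j then k - 1 else k)
    (hfin.mem_toFinset.2 (max_mem_latticeConcave hij hk))
    (fun K hK => le_max_of_mem_latticeConcave (hfin.mem_toFinset.1 hK))
    (fun K hK L hL => hfin.mem_toFinset.2
      (inf_mem_latticeConcave (hfin.mem_toFinset.1 hK) (hfin.mem_toFinset.1 hL)))
    (fun K hK L hL hle hne => by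
      simpa only [hfin.mem_toFinset] using exists_sub_single_mem_latticeConcave hij
        (hfin.mem_toFinset.1 hK) (hfin.mem_toFinset.1 hL) hle hne)
  simp only [hfin.mem_toFinset] at hsum
  have htop : (∏ a ∈ Finset.Ioo i j, (zF i j (a - 1) * qF i j ^ 2 / zF i j a) ^
        (if a ≤ i then 0 else if a < j then k - 1 else k)) *
      (zF i j (j - 1) * uF i j ^ (j - 1)) ^ (k - 1) =
      (qF i j ^ 2 * uF i j) ^ ((k - 1) * (j - i - 1)) * (zF i j i * uF i j ^ i) ^ (k - 1) := by
    have h1 := prod_Ico_zpow_sub (fun a => zF i j a * uF i j ^ a) (fun _ => k - 1) i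
      (show i + 1 ≤ j by omega) hw
    have h2 : ∏ a ∈ Finset.Ioo i j, (qF i j ^ 2 * uF i j) ^ (k - 1) =
        (qF i j ^ 2 * uF i j) ^ ((k - 1) * (j - i - 1)) := by
      rw [← zpow_sum_eq_prod hP, Finset.sum_const, Int.card_Ioo, nsmul_eq_mul,
        Int.toNat_of_nonneg (by omega)]
      congr 1
      ring
    have h3 : ∏ a ∈ Finset.Ioo i j, (zF i j (a - 1) * qF i j ^ 2 / zF i j a) ^
          (if a ≤ i then 0 else if a < j then k - 1 else k) =
        (∏ a ∈ Finset.Ioo i j, (qF i j ^ 2 * uF i j) ^ (k - 1)) *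
          ∏ a ∈ Finset.Ioo i j,
            (zF i j (a - 1) * uF i j ^ (a - 1) / (zF i j a * uF i j ^ a)) ^ (k - 1) := by
      rw [← Finset.prod_mul_distrib]
      refine Finset.prod_congr rfl fun a ha => ?_
      rw [Finset.mem_Ioo] at ha
      have hz := zF_ne_zero ha.1.le ha.2
      rw [if_neg (by omega), if_pos ha.2, ← mul_zpow, zpow_sub_one₀ hu]
      congr 1
      have := zpow_ne_zero a hu
      field_simp
    simp only [sub_self, zpow_zero, Finset.prod_const_one] at h1
    have hwi := zpow_ne_zero (k - 1) (hw i le_rfl hij)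
    rw [zpow_neg] at h1
    rw [h3, h2]
    have hinv := mul_inv_cancel₀ hwi
    set T := ∏ a ∈ Finset.Ioo i j,
      (zF i j (a - 1) * uF i j ^ (a - 1) / (zF i j a * uF i j ^ a)) ^ (k - 1)
    linear_combination (-(qF i j ^ 2 * uF i j) ^ ((k - 1) * (j - i - 1)) *
      (zF i j i * uF i j ^ i) ^ (k - 1)) * h1 -
      (qF i j ^ 2 * uF i j) ^ ((k - 1) * (j - i - 1)) * T *
        (zF i j (j - 1) * uF i j ^ (j - 1)) ^ (k - 1) * hinv
  rw [finsum_mem_eq_of_bijOn (g := fun G : ℤ → ℤ =>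
      (qF i j ^ 2 * uF i j) ^ (k - (k - 1) * (j - i)) * (-(qF i j ^ 2 * uF i j)) ^ (i - j) *
        (zF i j (j - 1) * uF i j ^ (j - 1)) ^ k *
      ((∏ a ∈ Finset.Ioo i j, (zF i j (a - 1) * qF i j ^ 2 / zF i j a) ^ G a) *
        ∏ a ∈ Finset.Ioo i j with G - Pi.single a 1 ∈ latticeConcave i j k,
          (1 - (zF i j (a - 1) * qF i j ^ 2 / zF i j a)⁻¹)))
      _ (bijOn_chainHeight hij) fun ⟨t, c, kk⟩ h => by
        convert ChainValid.chainTerm_eq h,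
    finsum_mem_eq_finite_toFinset_sum _ hfin, ← Finset.mul_sum, hsum]
  have hW := zpow_add₀ (hw (j - 1) (by omega) (by omega)) (k - 1) 1
  have hwk := zpow_add₀ (hw i le_rfl hij) (k - 1) 1
  rw [sub_add_cancel, zpow_one] at hW hwk
  have hexp : (qF i j ^ 2 * uF i j) ^ (k - (k - 1) * (j - i)) *
      (qF i j ^ 2 * uF i j) ^ ((k - 1) * (j - i - 1)) = qF i j ^ 2 * uF i j := by
    rw [← zpow_add₀ hP, show k - (k - 1) * (j - i) + (k - 1) * (j - i - 1) = 1 by ring, zpow_one]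
  have hsign : (qF i j ^ 2 * uF i j) * (-(qF i j ^ 2 * uF i j)) ^ (i - j) * uF i j ^ (j - 1) =
      -(uF i j ^ i) / (-(qF i j ^ 2)) ^ (j - i - 1) := by
    rw [← neg_mul, mul_zpow, show i - j = -(j - i - 1) - 1 by ring,
      zpow_sub_one₀ (neg_ne_zero.2 (pow_ne_zero 2 hq)), zpow_neg,
      show j - 1 = i + (j - i - 1) by ring, zpow_add₀ hu, zpow_sub_one₀ hu, zpow_neg]
    have h1 : (-(qF i j ^ 2)) ^ (j - i - 1) ≠ 0 :=
      zpow_ne_zero _ (neg_ne_zero.2 (pow_ne_zero 2 hq))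
    have h2 : uF i j ^ (j - i - 1) ≠ 0 := zpow_ne_zero _ hu
    field_simp
  have hz := zF_ne_zero le_rfl hij
  have hrhs : (zF i j i * uF i j ^ i) ^ k * (-(zF i j (j - 1))) /
      (zF i j i * (-(qF i j ^ 2)) ^ (j - i - 1)) =
      (zF i j i * uF i j ^ i) ^ (k - 1) * zF i j (j - 1) *
        (-(uF i j ^ i) / (-(qF i j ^ 2)) ^ (j - i - 1)) := by
    rw [hwk]
    field_simp
  rw [hrhs, ← hsign, hW]
  set T := ∏ a ∈ Finset.Ioo i j, (zF i j (a - 1) * qF i j ^ 2 / zF i j a) ^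
    (if a ≤ i then 0 else if a < j then k - 1 else k)
  linear_combination (qF i j ^ 2 * uF i j) ^ (k - (k - 1) * (j - i)) *
    (-(qF i j ^ 2 * uF i j)) ^ (i - j) * (zF i j (j - 1) * uF i j ^ (j - 1)) * htop +
    (-(qF i j ^ 2 * uF i j)) ^ (i - j) * (zF i j (j - 1) * uF i j ^ (j - 1)) *
      (zF i j i * uF i j ^ i) ^ (k - 1) * hexp

end
end
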